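/- arXiv:1402.2543 — 6 statements merged into one kernel-verified Lean document; each statement's English description precedes it below -/
import Mathlib

section
/- For every integer d ≥ 2, setting τ = ⌈(d + √d)/2⌉, one has 4^{-(d-1)} · C(d-1, τ-1) · Σ_{i = d-τ+1}^{τ-1} C(d-1, i) ≥ 9/(32·√d). -/
/-- Binomial coefficient with integer lower index, following the convention
`C(n,k) = 0` for `k < 0` (and `k > n`). -/
def chooseZ (n : ℕ) (k : ℤ) : ℕ := if 0 ≤ k then n.choose k.toNat else 0

open Finset in
lemma sum_chooseZ_Icc (n a b : ℕ) :
    ∑ i ∈ Icc (a : ℤ) b, (chooseZ n i : ℝ) = ∑ i ∈ Ico a (b + 1), (n.choose i : ℝ) := by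
  symm
  refine sum_bij (fun i _ => (i : ℤ)) ?_ ?_ ?_ ?_
  · intro i hi
    simp only [mem_Ico, mem_Icc] at hi ⊢
    omega
  · intro i _ j _ h
    exact_mod_cast h
  · intro i hi
    simp only [mem_Icc] at hi
    refine ⟨i.toNat, ?_, ?_⟩
    · simp only [mem_Ico]
      omega
    · omega
  · intro i _
    simp [chooseZ]

open Finset in
lemma sum_Ico_pred_succ (f : ℕ → ℝ) {a b : ℕ} (h : a + 1 ≤ b) :
    ∑ i ∈ Ico a (b + 1), f i = f a + ∑ i ∈ Ico (a + 1) b, f i + f b := by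
  rw [sum_Ico_succ_top (by omega), sum_eq_sum_Ico_succ_bot (by omega)]

/-- The sequence `n * (centralBinom n / 4 ^ n) ^ 2` is increasing (with limit `1 / π`). -/
lemma le_mul_centralBinom_div_sq {n : ℕ} (hn : 99 ≤ n) :
    (0.317 : ℝ) ≤ ((n.centralBinom : ℝ) / 4 ^ n) ^ 2 * n := by
  induction n, hn using Nat.le_induction with
  | base =>
    have h : 317 * 16 ^ 99 ≤ 1000 * 99 * Nat.centralBinom 99 ^ 2 := by
      rw [Nat.centralBinom_eq_two_mul_choose, Nat.choose_eq_descFactorial_div_factorial]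
      decide +kernel
    have h' : (317 : ℝ) * 16 ^ 99 ≤ 1000 * 99 * (Nat.centralBinom 99 : ℝ) ^ 2 := by
      exact_mod_cast h
    rw [div_pow, div_mul_eq_mul_div, le_div_iff₀ (by positivity), ← pow_mul, mul_comm 99 2,
      pow_mul, show (4 : ℝ) ^ 2 = 16 by norm_num, Nat.cast_ofNat]
    linarith
  | succ n hn ih =>
    refine ih.trans ?_
    have h : ((n : ℝ) + 1) * (n + 1).centralBinom = 2 * (2 * n + 1) * n.centralBinom := by
      exact_mod_cast Nat.succ_mul_centralBinom_succ n
    have hn0 : (0 : ℝ) < n := by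
      have : 0 < n := by omega
      exact_mod_cast this
    have h' : ((n + 1).centralBinom : ℝ) = 2 * (2 * n + 1) * n.centralBinom / (n + 1) := by
      field_simp
      linarith
    have key : (((n + 1).centralBinom : ℝ) / 4 ^ (n + 1)) ^ 2 * ((n + 1 : ℕ) : ℝ)
        = ((n.centralBinom : ℝ) / 4 ^ n) ^ 2 * ((2 * n + 1) ^ 2 / (4 * (n + 1))) := by
      rw [h', pow_succ]
      push_cast
      field_simp
      ring
    rw [key]
    refine mul_le_mul_of_nonneg_left ?_ (sq_nonneg _)
    rw [le_div_iff₀ (by positivity)]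
    nlinarith

lemma centralBinom_mul_le_choose {N j : ℕ} (hj : j ≤ N) :
    (N.centralBinom : ℝ) * (1 - (j : ℝ) ^ 2 / (N + 1)) ≤ (2 * N).choose (N + j) := by
  induction j with
  | zero => simp [Nat.centralBinom_eq_two_mul_choose]
  | succ j ih =>
    have ih := ih (by omega)
    have hr : ((2 * N).choose (N + (j + 1)) : ℝ) * (N + j + 1)
        = (2 * N).choose (N + j) * (N - j) := by
      have := Nat.choose_succ_right_eq (2 * N) (N + j)
      rw [show 2 * N - (N + j) = N - j by omega] at this
      have h2 : ((N - j : ℕ) : ℝ) = N - j := Nat.cast_sub (by omega)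
      rw [← h2]
      exact_mod_cast this
    have hjN : (j : ℝ) + 1 ≤ N := by exact_mod_cast hj
    have hj0 : (0 : ℝ) ≤ j := by positivity
    have hr' : ((2 * N).choose (N + (j + 1)) : ℝ)
        = (2 * N).choose (N + j) * (1 - (2 * j + 1) / (N + j + 1)) := by
      field_simp
      linarith
    rw [hr']
    have hb : (2 * (j : ℝ) + 1) / (N + j + 1) ≤ (2 * j + 1) / (N + 1) := by
      gcongr
      linarith
    have hb1 : (2 * (j : ℝ) + 1) / (N + j + 1) ≤ 1 := by
      rw [div_le_one (by positivity)]
      linarith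
    have hb0 : 0 ≤ (2 * (j : ℝ) + 1) / (N + j + 1) := by positivity
    have ha0 : 0 ≤ (j : ℝ) ^ 2 / (N + 1) := by positivity
    refine le_trans ?_ (mul_le_mul_of_nonneg_right ih (by linarith))
    rw [mul_assoc]
    refine mul_le_mul_of_nonneg_left ?_ (by positivity)
    have e : ((j + 1 : ℕ) : ℝ) ^ 2 / (N + 1) = (j : ℝ) ^ 2 / (N + 1) + (2 * j + 1) / (N + 1) := by
      push_cast
      field_simp
      ring
    rw [e]
    nlinarith [mul_nonneg ha0 hb0]

/-- A Gaussian lower bound for the binomial coefficients to the right of the middle. -/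
lemma choose_mul_exp_le_choose {n k e J j : ℕ} (he : 2 * k + 1 = n + e) (hJ : k + J ≤ n)
    (hj : j ≤ J) :
    (n.choose k : ℝ) * Real.exp (-((j * (e + j - 1) : ℝ) / (n - k - J + 1)))
      ≤ n.choose (k + j) := by
  induction j with
  | zero => simp
  | succ j ih =>
    have ih := ih (by omega)
    have hJ' : (k : ℝ) + J ≤ n := by exact_mod_cast hJ
    have hj' : (j : ℝ) + 1 ≤ J := by exact_mod_cast hj
    have he' : 2 * (k : ℝ) + 1 = n + e := by exact_mod_cast he
    have hpos : (0 : ℝ) < n - k - j := by linarith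
    have hr : (n.choose (k + (j + 1)) : ℝ) * (k + j + 1) = n.choose (k + j) * (n - k - j) := by
      have := Nat.choose_succ_right_eq n (k + j)
      have h2 : ((n - (k + j) : ℕ) : ℝ) = n - k - j := by
        rw [Nat.cast_sub (by omega)]
        push_cast
        ring
      rw [← h2]
      exact_mod_cast this
    have hx : Real.exp (-((e + 2 * j : ℝ) / (n - k - J + 1))) * (k + j + 1) ≤ n - k - j := by
      have h1 : (e + 2 * j : ℝ) / (n - k - j) ≤ (e + 2 * j : ℝ) / (n - k - J + 1) := by
        apply div_le_div_of_nonneg_left (by positivity) (by linarith) (by linarith)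
      have h2 : (k + j + 1 : ℝ) ≤ (n - k - j) * Real.exp ((e + 2 * j : ℝ) / (n - k - J + 1)) := by
        have h3 := Real.add_one_le_exp ((e + 2 * j : ℝ) / (n - k - J + 1))
        have h4 : (k + j + 1 : ℝ) = (n - k - j) * ((e + 2 * j : ℝ) / (n - k - j) + 1) := by
          field_simp
          linarith
        rw [h4]
        exact mul_le_mul_of_nonneg_left (by linarith) hpos.le
      rw [Real.exp_neg, inv_mul_le_iff₀ (Real.exp_pos _)]
      linarith
    have hk : (0 : ℝ) < k + j + 1 := by positivity
    have hsplit : Real.exp (-((((j + 1 : ℕ) : ℝ) * (e + ((j + 1 : ℕ) : ℝ) - 1)) / (n - k - J + 1)))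
        = Real.exp (-((j * (e + j - 1) : ℝ) / (n - k - J + 1)))
          * Real.exp (-((e + 2 * j : ℝ) / (n - k - J + 1))) := by
      rw [← Real.exp_add]
      congr 1
      push_cast
      ring
    rw [hsplit, ← mul_assoc]
    refine le_of_mul_le_mul_right ?_ hk
    rw [hr, mul_assoc]
    exact mul_le_mul ih hx (by positivity) (by positivity)

open Finset in
lemma le_sum_choose_even {N M : ℕ} (hM : M ≤ N) :
    (N.centralBinom : ℝ) * (2 * M - (2 * M ^ 3 + M) / (3 * (N + 1)))
      ≤ ∑ i ∈ Ico (N - M + 1) (N + M + 1), ((2 * N).choose i : ℝ) := by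
  induction M with
  | zero => simp
  | succ M ih =>
    have ih := ih (by omega)
    rw [show N - (M + 1) + 1 = N - M by omega, ← add_assoc N M 1,
      sum_Ico_pred_succ _ (by omega)]
    have h1 := centralBinom_mul_le_choose (N := N) (j := M) (by omega)
    have h2 := centralBinom_mul_le_choose (N := N) (j := M + 1) (by omega)
    have h3 : (2 * N).choose (N - M) = (2 * N).choose (N + M) :=
      Nat.choose_symm_of_eq_add (by omega)
    rw [h3, add_assoc N M 1]
    refine le_trans (le_of_eq ?_) (add_le_add (add_le_add h1 ih) h2)
    push_cast
    field_simp
    ring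

lemma centralBinom_eq_two_mul_choose_pred {D : ℕ} (hD : 0 < D) :
    D.centralBinom = 2 * (2 * D - 1).choose D := by
  obtain ⟨E, rfl⟩ : ∃ E, D = E + 1 := ⟨D - 1, by omega⟩
  rw [Nat.centralBinom_eq_two_mul_choose, show 2 * (E + 1) - 1 = 2 * E + 1 by omega,
    show 2 * (E + 1) = 2 * E + 1 + 1 by ring, Nat.choose_succ_succ,
    Nat.choose_symm_of_eq_add (show 2 * E + 1 = E + (E + 1) by ring)]
  ring

open Finset in
lemma le_two_mul_sum_choose_odd {D J : ℕ} (hJ : J < D) :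
    (D.centralBinom : ℝ) * ((2 * J + 1) * (1 - J * (J + 1) / (3 * (D + 1))))
      ≤ 2 * ∑ i ∈ Ico (D - J) (D + J + 1), ((2 * D - 1).choose i : ℝ) := by
  induction J with
  | zero => simp [centralBinom_eq_two_mul_choose_pred hJ]
  | succ J ih =>
    have ih := ih (by omega)
    rw [← add_assoc D J 1, sum_Ico_pred_succ _ (by omega),
      show D - (J + 1) + 1 = D - J by omega]
    have h2 := centralBinom_mul_le_choose (N := D) (j := J + 1) (by omega)
    have h3 : (2 * D).choose (D + (J + 1))
        = (2 * D - 1).choose (D - (J + 1)) + (2 * D - 1).choose (D + J + 1) := by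
      rw [Nat.choose_symm_of_eq_add (show 2 * D - 1 = (D - (J + 1)) + (D + J) by omega),
        ← Nat.choose_succ_succ, show (2 * D - 1).succ = 2 * D by omega]
      rfl
    rw [h3] at h2
    push_cast at h2 ⊢
    have e : (D.centralBinom : ℝ)
          * ((2 * (J + 1) + 1) * (1 - (J + 1) * ((J : ℝ) + 1 + 1) / (3 * (D + 1))))
        = D.centralBinom * ((2 * J + 1) * (1 - J * (J + 1) / (3 * (D + 1))))
          + 2 * (D.centralBinom * (1 - ((J : ℝ) + 1) ^ 2 / (D + 1))) := by
      field_simp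
      ring
    rw [e]
    linarith

lemma mul_le_exp_neg (z : ℝ) : 0.6065 * (1.5 - z) ≤ Real.exp (-z) := by
  have h1 : (0.6065 : ℝ) ≤ Real.exp (-(1 / 2)) := by
    have h2 : Real.exp (1 / 2) ≤ 1.6488 := by
      have h3 : Real.exp (1 / 2) ^ 2 = Real.exp 1 := by
        rw [← Real.exp_nat_mul]
        norm_num
      have h4 := Real.exp_one_lt_d9
      refine le_of_sq_le_sq ?_ (by norm_num)
      rw [h3]
      norm_num at h4 ⊢
      linarith
    rw [Real.exp_neg, le_inv_comm₀ (by norm_num) (Real.exp_pos _)]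
    refine h2.trans (by norm_num)
  have h2 : Real.exp (-z) = Real.exp (-(1 / 2)) * Real.exp (1 / 2 - z) := by
    rw [← Real.exp_add]
    congr 1
    ring
  have h3 := Real.add_one_le_exp (1 / 2 - z)
  rcases le_total z 1.5 with h | h
  · rw [h2]
    refine mul_le_mul h1 (by linarith) (by linarith) (Real.exp_pos _).le
  · exact le_trans (by nlinarith) (Real.exp_pos (-z)).le

lemma mul_mul_ge_of_gaussian_bounds {A P S Q L s z : ℝ} (hA0 : 0 ≤ A) (hQ : 0 < Q) (hL : 0 ≤ L)
    (hs : 0 ≤ s) (hz1 : 0.46 ≤ z) (hz2 : z ≤ 0.61) (hA : 0.317 ≤ A ^ 2 * Q)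
    (hP : A * Real.exp (-z) ≤ P) (hS : A * (L * (1 - z / 3)) ≤ S)
    (hw : 7.4 * z * Q ^ 2 ≤ (L * s) ^ 2) : 9 / 32 ≤ P * S * s := by
  have hE := mul_le_exp_neg z
  have hz3 : 0 ≤ 1 - z / 3 := by linarith
  have hPS : (A * (0.6065 * (1.5 - z))) * (A * (L * (1 - z / 3))) ≤ P * S := by
    refine mul_le_mul (le_trans ?_ hP) hS (by positivity) (le_trans (by positivity) hP)
    exact mul_le_mul_of_nonneg_left hE hA0
  have hw1 : 0.985 + 1.865 * z ≤ L * s / Q := by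
    refine le_of_sq_le_sq ?_ (by positivity)
    rw [div_pow, le_div_iff₀ (by positivity)]
    refine le_trans (mul_le_mul_of_nonneg_right ?_ (sq_nonneg Q)) hw
    nlinarith
  have hz4 : 0 ≤ (1.5 - z) * (1 - z / 3) := mul_nonneg (by linarith) hz3
  calc (9 / 32 : ℝ) ≤ 0.317 * (0.6065 * ((1.5 - z) * (1 - z / 3) * (0.985 + 1.865 * z))) := by
        nlinarith [mul_nonneg (sub_nonneg.2 hz1) (sub_nonneg.2 hz2),
          mul_nonneg (mul_nonneg (sub_nonneg.2 hz1) (sub_nonneg.2 hz2)) (sub_nonneg.2 hz1)]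
    _ ≤ (A ^ 2 * Q) * (0.6065 * ((1.5 - z) * (1 - z / 3) * (L * s / Q))) := by
        refine mul_le_mul hA ?_ ?_ (by positivity)
        · gcongr
        · have : 0 ≤ 0.985 + 1.865 * z := by linarith
          positivity
    _ = (A * (0.6065 * (1.5 - z))) * (A * (L * (1 - z / 3))) * s := by
        field_simp
    _ ≤ P * S * s := mul_le_mul_of_nonneg_right hPS hs

open Finset in
lemma choose_mul_sum_ge_even_of_large {N M : ℕ} (hM : 8 ≤ M) (h1 : 2 * M * (M - 1) < N)
    (h2 : N ≤ 2 * M * (M + 1)) :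
    9 / 32 ≤ ((2 * N).choose (N + M) : ℝ) / 4 ^ N
      * ((∑ i ∈ Ico (N - M + 1) (N + M + 1), ((2 * N).choose i : ℝ)) / 4 ^ N)
      * √((2 * N + 1 : ℕ) : ℝ) := by
  obtain ⟨m, rfl⟩ : ∃ m, M = m + 1 := ⟨M - 1, by omega⟩
  have hMN : m + 1 ≤ N := by nlinarith [show m + 1 - 1 = m by omega]
  have hN : 99 ≤ N := by nlinarith [show m + 1 - 1 = m by omega]
  have hm : (8 : ℝ) ≤ (m : ℝ) + 1 := by exact_mod_cast hM
  have h1' : 2 * ((m : ℝ) + 1) * m + 1 ≤ N := by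
    rw [show m + 1 - 1 = m by omega] at h1
    exact_mod_cast h1
  have h2' : (N : ℝ) ≤ 2 * (m + 1) * (m + 2) := by exact_mod_cast h2
  have hQ : (0 : ℝ) < N - m := by nlinarith
  have hexp := choose_mul_exp_le_choose (n := 2 * N) (k := N) (e := 1) (J := m + 1) (j := m + 1)
    rfl (by omega) le_rfl
  have hsum := le_sum_choose_even hMN
  have hz : ((m : ℝ) + 1) ^ 2 / (N - m) * (N - m) = (m + 1) ^ 2 := by field_simp
  refine mul_mul_ge_of_gaussian_bounds (A := N.centralBinom / 4 ^ N) (Q := N)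
    (L := 2 * (m + 1)) (z := ((m : ℝ) + 1) ^ 2 / (N - m)) (by positivity) (by linarith)
    (by positivity) (by positivity) ?_ ?_ (le_mul_centralBinom_div_sq hN) ?_ ?_ ?_
  · rw [le_div_iff₀ hQ]
    nlinarith
  · rw [div_le_iff₀ hQ]
    nlinarith
  · rw [div_mul_eq_mul_div, Nat.centralBinom_eq_two_mul_choose]
    refine div_le_div_of_nonneg_right (le_trans (le_of_eq ?_) hexp) (by positivity)
    congr 3
    push_cast
    ring_nf
  · rw [div_mul_eq_mul_div]
    refine div_le_div_of_nonneg_right (le_trans ?_ hsum) (by positivity)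
    refine mul_le_mul_of_nonneg_left ?_ (by positivity)
    have h3 : (((m : ℝ) + 1) ^ 2 + 1 / 2) / (N + 1) ≤ (m + 1) ^ 2 / (N - m) := by
      rw [div_le_div_iff₀ (by positivity) hQ]
      nlinarith [pow_nonneg (show (0 : ℝ) ≤ m by positivity) 3]
    have h4 : (2 * ((m + 1 : ℕ) : ℝ) - (2 * ((m + 1 : ℕ) : ℝ) ^ 3 + ((m + 1 : ℕ) : ℝ))
          / (3 * (N + 1)))
        = 2 * (m + 1) * (1 - (((m : ℝ) + 1) ^ 2 + 1 / 2) / (N + 1) / 3) := by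
      push_cast
      field_simp
    rw [h4]
    gcongr
  · rw [mul_pow, Real.sq_sqrt (by positivity)]
    set z := ((m : ℝ) + 1) ^ 2 / (N - m)
    have hz0 : 0 ≤ z := by positivity
    have h5 : 7.4 * (N : ℝ) ≤ 8 * (N - m) := by nlinarith
    push_cast
    calc 7.4 * z * (N : ℝ) ^ 2 = z * (7.4 * N) * N := by ring
      _ ≤ z * (8 * (N - m)) * N := by gcongr
      _ = 8 * (z * (N - m)) * N := by ring
      _ ≤ (2 * (m + 1)) ^ 2 * (2 * N + 1) := by
        rw [hz]
        nlinarith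

open Finset in
lemma choose_mul_sum_ge_odd_of_large {D J : ℕ} (hJ : 7 ≤ J) (h1 : 2 * J ^ 2 < D)
    (h2 : D ≤ 2 * (J + 1) ^ 2) :
    9 / 32 ≤ ((2 * D - 1).choose (D + J) : ℝ) / 2 ^ (2 * D - 1)
      * ((∑ i ∈ Ico (D - J) (D + J + 1), ((2 * D - 1).choose i : ℝ)) / 2 ^ (2 * D - 1))
      * √((2 * D : ℕ) : ℝ) := by
  have hJD : J < D := by nlinarith
  have hJD2 : D + J ≤ 2 * D - 1 := by omega
  have hJ' : (7 : ℝ) ≤ J := by exact_mod_cast hJ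
  have h1' : 2 * (J : ℝ) ^ 2 + 1 ≤ D := by exact_mod_cast h1
  have h2' : (D : ℝ) ≤ 2 * (J + 1) ^ 2 := by exact_mod_cast h2
  have hQ : (0 : ℝ) < D - J := by nlinarith
  have hexp := choose_mul_exp_le_choose (n := 2 * D - 1) (k := D) (e := 2) (J := J) (j := J)
    (by omega) hJD2 le_rfl
  have hsum := le_two_mul_sum_choose_odd hJD
  have hmid : (D.centralBinom : ℝ) = 2 * (2 * D - 1).choose D := by
    exact_mod_cast centralBinom_eq_two_mul_choose_pred (by omega)
  have hpow : (4 : ℝ) ^ D = 2 * 2 ^ (2 * D - 1) := by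
    rw [← pow_succ', show 2 * D - 1 + 1 = 2 * D by omega, pow_mul]
    norm_num
  have hz : (J : ℝ) * (J + 1) / (D - J) * (D - J) = J * (J + 1) := by field_simp
  refine mul_mul_ge_of_gaussian_bounds (A := D.centralBinom / 4 ^ D) (Q := D)
    (L := 2 * J + 1) (z := (J : ℝ) * (J + 1) / (D - J)) (by positivity) (by linarith)
    (by positivity) (by positivity) ?_ ?_ (le_mul_centralBinom_div_sq (by nlinarith)) ?_ ?_ ?_
  · rw [le_div_iff₀ hQ]
    nlinarith
  · rw [div_le_iff₀ hQ]
    nlinarith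
  · rw [hmid, hpow, mul_div_mul_left _ _ two_ne_zero, div_mul_eq_mul_div]
    refine div_le_div_of_nonneg_right (le_trans (le_of_eq ?_) hexp) (by positivity)
    congr 3
    rw [Nat.cast_sub (by omega)]
    push_cast
    ring_nf
  · rw [hpow, div_mul_eq_mul_div, div_le_div_iff₀ (by positivity) (by positivity)]
    have h3 : (J : ℝ) * (J + 1) / (D + 1) ≤ J * (J + 1) / (D - J) := by
      apply div_le_div_of_nonneg_left (by positivity) hQ
      linarith
    have h4 : (2 * J + 1) * (1 - (J : ℝ) * (J + 1) / (D - J) / 3)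
        ≤ (2 * J + 1) * (1 - J * (J + 1) / (3 * (D + 1))) := by
      have : (J : ℝ) * (J + 1) / (3 * (D + 1)) = J * (J + 1) / (D + 1) / 3 := by
        field_simp
      rw [this]
      gcongr
    have h5 := (mul_le_mul_of_nonneg_left h4 (Nat.cast_nonneg (α := ℝ) D.centralBinom)).trans hsum
    calc _ ≤ _ := mul_le_mul_of_nonneg_right h5 (by positivity)
      _ = _ := by ring
  · rw [mul_pow, Real.sq_sqrt (by positivity)]
    set z := (J : ℝ) * (J + 1) / (D - J)
    have hz0 : 0 ≤ z := by positivity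
    have h5 : 7.4 * (D : ℝ) ≤ 8 * (D - J) := by nlinarith
    push_cast
    calc 7.4 * z * (D : ℝ) ^ 2 = z * (7.4 * D) * D := by ring
      _ ≤ z * (8 * (D - J)) * D := by gcongr
      _ = 8 * (z * (D - J)) * D := by ring
      _ ≤ (2 * J + 1) ^ 2 * (2 * D) := by
        rw [hz]
        nlinarith

open Finset in
lemma choose_mul_sum_sq_ge_even_of_small : ∀ M < 8, ∀ N < 113, 2 * M * (M - 1) < N →
    N ≤ 2 * M * (M + 1) →
    81 * 16 ^ (2 * N) ≤ (32 * ((2 * N).choose (N + M)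
      * ∑ i ∈ Ico (N - M + 1) (N + M + 1), (2 * N).choose i)) ^ 2 * (2 * N + 1) := by
  simp only [Nat.choose_eq_descFactorial_div_factorial]
  decide +kernel

open Finset in
lemma choose_mul_sum_sq_ge_odd_of_small : ∀ J < 7, ∀ D < 99, 1 ≤ D → (J = 0 ∨ 2 * J ^ 2 < D) →
    D ≤ 2 * (J + 1) ^ 2 →
    81 * 16 ^ (2 * D - 1) ≤ (32 * ((2 * D - 1).choose (D + J)
      * ∑ i ∈ Ico (D - J) (D + J + 1), (2 * D - 1).choose i)) ^ 2 * (2 * D) := by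
  simp only [Nat.choose_eq_descFactorial_div_factorial]
  decide +kernel

lemma mul_sqrt_ge_of_sq_le {c n d : ℕ} (h : 81 * 16 ^ n ≤ (32 * c) ^ 2 * d) :
    9 / 32 ≤ (c : ℝ) / 4 ^ n * √(d : ℝ) := by
  have h' : (81 : ℝ) * 16 ^ n ≤ (32 * c) ^ 2 * d := by exact_mod_cast h
  refine le_of_sq_le_sq ?_ (by positivity)
  rw [mul_pow, div_pow (c : ℝ), Real.sq_sqrt (by positivity), div_mul_eq_mul_div,
    le_div_iff₀ (by positivity), ← pow_mul, mul_comm n 2, pow_mul]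
  norm_num
  linarith

theorem stmt3 (d : ℕ) (hd : 2 ≤ d) (τ : ℤ)
    (hτ : τ = ⌈((d : ℝ) + Real.sqrt d) / 2⌉) :
    (chooseZ (d-1) (τ - 1) : ℝ) / 4 ^ (d-1)
      * ∑ i ∈ Finset.Icc ((d : ℤ) - τ + 1) (τ - 1), (chooseZ (d-1) i : ℝ)
    ≥ 9 / (32 * Real.sqrt d) := by
  have hd0 : (0 : ℝ) < d := by
    have : 0 < d := by omega
    exact_mod_cast this
  have hs0 : 0 < √(d : ℝ) := Real.sqrt_pos.2 hd0
  have hs2 : √(d : ℝ) ^ 2 = d := Real.sq_sqrt hd0.le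
  obtain ⟨hlt, hle⟩ := Int.ceil_eq_iff.1 hτ.symm
  have hle' : √(d : ℝ) ≤ 2 * τ - d := by linarith
  have hlt' : 2 * (τ : ℝ) - d - 2 < √(d : ℝ) := by linarith
  have hm0 : 0 < 2 * τ - d := by
    have : (0 : ℝ) < 2 * τ - d := by linarith
    exact_mod_cast this
  have hup : (d : ℤ) ≤ (2 * τ - d) ^ 2 := by
    have : (d : ℝ) ≤ (2 * τ - d) ^ 2 := by nlinarith
    exact_mod_cast this
  have hlow : 2 * τ - d - 2 ≤ 0 ∨ (2 * τ - d - 2) ^ 2 < (d : ℤ) := by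
    rcases le_or_gt (2 * τ - d - 2) 0 with h | h
    · exact Or.inl h
    · have h' : (0 : ℝ) < 2 * τ - d - 2 := by exact_mod_cast h
      have : (2 * (τ : ℝ) - d - 2) ^ 2 < d := by nlinarith
      exact Or.inr (by exact_mod_cast this)
  suffices h : ∀ k : ℕ, τ = k + 1 → ∀ a : ℕ, (d : ℤ) - k = a →
      9 / 32 ≤ ((d - 1).choose k : ℝ) / 4 ^ (d - 1)
        * (∑ i ∈ Finset.Ico a (k + 1), ((d - 1).choose i : ℝ)) * √(d : ℝ) by
    have hτd : τ ≤ d := by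
      rw [hτ, Int.ceil_le]
      have : (2 : ℝ) ≤ d := by exact_mod_cast hd
      push_cast
      nlinarith
    obtain ⟨k, hk⟩ : ∃ k : ℕ, τ = k + 1 := ⟨(τ - 1).toNat, by omega⟩
    obtain ⟨a, ha⟩ : ∃ a : ℕ, (d : ℤ) - k = a := ⟨((d : ℤ) - k).toNat, by omega⟩
    have h := h k hk a ha
    rw [hk, show (d : ℤ) - (k + 1) + 1 = a by omega, show (k : ℤ) + 1 - 1 = k by ring,
      sum_chooseZ_Icc, show chooseZ (d - 1) k = (d - 1).choose k by simp [chooseZ], ge_iff_le,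
      ← div_div, div_le_iff₀ hs0]
    exact h
  intro k hk a ha
  rcases Nat.even_or_odd' d with ⟨N, rfl | rfl⟩
  · obtain ⟨J, rfl⟩ : ∃ J : ℕ, k = N + J := ⟨k - N, by push_cast at *; omega⟩
    obtain rfl : a = N - J := by push_cast at *; omega
    subst hk
    have hu : N ≤ 2 * (J + 1) ^ 2 := by
      push_cast at hup
      zify
      nlinarith
    have hl : J = 0 ∨ 2 * J ^ 2 < N := by
      push_cast at hlow
      rcases hlow with h | h
      · left
        omega
      · right
        zify
        nlinarith
    rcases lt_or_ge J 7 with hJ | hJ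
    · have hN : N < 99 := by nlinarith
      have := mul_sqrt_ge_of_sq_le
        (choose_mul_sum_sq_ge_odd_of_small J hJ N hN (by omega) hl hu)
      push_cast at this ⊢
      rw [div_mul_eq_mul_div]
      exact this
    · refine (choose_mul_sum_ge_odd_of_large hJ (by omega) hu).trans (le_of_eq ?_)
      rw [show (4 : ℝ) ^ (2 * N - 1) = 2 ^ (2 * N - 1) * 2 ^ (2 * N - 1) by
        rw [← mul_pow]; norm_num]
      field_simp
  · obtain ⟨M, rfl⟩ : ∃ M : ℕ, k = N + M := ⟨k - N, by push_cast at *; omega⟩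
    subst hk
    have hM : 1 ≤ M := by
      by_contra h
      obtain rfl : M = 0 := by omega
      push_cast at hup
      ring_nf at hup
      omega
    obtain ⟨m, rfl⟩ : ∃ m, M = m + 1 := ⟨M - 1, by omega⟩
    have hu : N ≤ 2 * (m + 1) * (m + 1 + 1) := by
      push_cast at hup
      zify
      nlinarith
    have hl : 2 * (m + 1) * (m + 1 - 1) < N := by
      rw [Nat.add_sub_cancel]
      push_cast at hlow
      rcases hlow with h | h
      · obtain rfl : m = 0 := by omega
        omega
      · zify
        nlinarith
    obtain rfl : a = N - (m + 1) + 1 := by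
      have : m + 1 ≤ N := by
        rw [Nat.add_sub_cancel] at hl
        nlinarith
      push_cast at *
      omega
    rw [Nat.add_sub_cancel]
    rcases lt_or_ge (m + 1) 8 with hJ | hJ
    · have hN : N < 113 := by nlinarith
      have := mul_sqrt_ge_of_sq_le
        (choose_mul_sum_sq_ge_even_of_small (m + 1) hJ N hN hl hu)
      rw [div_mul_eq_mul_div]
      convert this using 3
      push_cast
      rfl
    · refine (choose_mul_sum_ge_even_of_large hJ hl hu).trans (le_of_eq ?_)
      rw [show (4 : ℝ) ^ (2 * N) = 4 ^ N * 4 ^ N by rw [two_mul, pow_add]]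
      field_simp
end

section
/- Let d ≥ 2 be an integer and set τ = ⌈(d + √d)/2⌉. Let G be a d-regular triangle-free simple graph on a finite vertex set V with edge set E. Then the average, over all 2^|V| functions c : V → {a,b}, of the number of edges {u,v} ∈ E with A_τ(c)(u) ≠ A_τ(c)(v), is at least (1/2 + 9/(32·√d)) · |E|. -/
section

open Finset

/-- `chooseLoop d n k (d.choose k) acc` adds `d.choose i` for `k ≤ i < k + n` to `acc`, and also
returns `d.choose (k + n)`. -/
def chooseLoop (d : ℕ) : ℕ → ℕ → ℕ → ℕ → ℕ × ℕ
  | 0, _, c, acc => (acc, c)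
  | n + 1, k, c, acc => chooseLoop d n (k + 1) (c * (d - k) / (k + 1)) (acc + c)

theorem chooseLoop_eq (d n k acc : ℕ) :
    chooseLoop d n k (d.choose k) acc =
      (acc + ∑ i ∈ range n, d.choose (k + i), d.choose (k + n)) := by
  induction n generalizing k acc with
  | zero => simp [chooseLoop]
  | succ n ih =>
    have h : d.choose k * (d - k) / (k + 1) = d.choose (k + 1) := by
      rw [← Nat.choose_succ_right_eq]
      exact Nat.mul_div_cancel _ k.succ_pos
    rw [chooseLoop, h, ih, sum_range_succ']
    ext <;> simp [add_assoc, add_comm, add_left_comm]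

/-- The inequality of `cut_gain_ge` for `2 * τ = d + s`, squared and cleared of denominators. -/
def cutCheck (d s : ℕ) : Bool :=
  let h := (d + 1) / 2
  let τ := (d + s) / 2
  let c := d.factorial / (h.factorial * (d - h).factorial)
  let r := chooseLoop d (τ - h) h c 0
  Nat.ble (81 * d * 4 ^ (2 * d - 1)) (1024 * (τ * r.2 * (2 * r.1 - (1 - d % 2) * c)) ^ 2)

theorem cutCheck_all : ∀ s < 27, ∀ e < 4 * s,
    (if 2 ≤ s ∧ 2 ≤ (s - 2) ^ 2 + 1 + e ∧ (s - 2) ^ 2 + 1 + e ≤ s ^ 2 ∧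
        ((s - 2) ^ 2 + 1 + e + s) % 2 = 0
      then cutCheck ((s - 2) ^ 2 + 1 + e) s else true) = true := by
  decide +kernel

/-- The trapezoidal rule bounds the sum of a concave sequence from below. -/
theorem two_mul_sum_ge_of_concave (f : ℕ → ℝ) (t : ℕ)
    (hf : ∀ i, i + 2 ≤ t → f i + f (i + 2) ≤ 2 * f (i + 1)) :
    ((t : ℝ) + 1) * f 0 + ((t : ℝ) - 1) * f t ≤ 2 * ∑ i ∈ range t, f i := by
  have key : ∀ k, k + 1 ≤ t → (k : ℝ) * (f (k + 1) - f k) ≤ f k - f 0 := by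
    intro k
    induction k with
    | zero => simp
    | succ k ih =>
      intro hk
      have h1 := ih (by omega)
      have h2 := hf k (by omega)
      have : (0 : ℝ) ≤ (k : ℝ) + 1 := by positivity
      push_cast
      nlinarith
  have main : ∀ k ≤ t, ((k : ℝ) + 1) * f 0 + ((k : ℝ) - 1) * f k ≤ 2 * ∑ i ∈ range k, f i := by
    intro k
    induction k with
    | zero => simp
    | succ k ih =>
      intro hk
      have h1 := ih (by omega)
      have h2 := key k hk
      rw [sum_range_succ]
      push_cast
      nlinarith
  exact main t le_rfl

theorem choose_concave {d k : ℕ} (hk : k + 1 ≤ d) (h : (2 * (k + 1 : ℝ) - d) ^ 2 ≤ d + 2) :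
    (d.choose k : ℝ) + d.choose (k + 2) ≤ 2 * d.choose (k + 1) := by
  have h1 : (d.choose (k + 2) : ℝ) * (k + 2) = d.choose (k + 1) * (d - (k + 1)) := by
    have := Nat.choose_succ_right_eq d (k + 1)
    rw [← Nat.cast_inj (R := ℝ)] at this
    push_cast [Nat.cast_sub hk] at this
    linarith
  have h2 : (d.choose (k + 1) : ℝ) * (k + 1) = d.choose k * (d - k) := by
    have := Nat.choose_succ_right_eq d k
    rw [← Nat.cast_inj (R := ℝ)] at this
    push_cast [Nat.cast_sub (show k ≤ d by omega)] at this
    linarith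
  have hd : (0 : ℝ) < d - k := by
    have : (k : ℝ) + 1 ≤ d := by exact_mod_cast hk
    linarith
  have hk2 : (0 : ℝ) < k + 2 := by positivity
  have e1 : (d.choose (k + 2) : ℝ) = d.choose (k + 1) * (d - (k + 1)) / (k + 2) := by
    field_simp; linarith
  have e2 : (d.choose k : ℝ) = d.choose (k + 1) * (k + 1) / (d - k) := by
    field_simp; linarith
  have e3 : ((k : ℝ) + 1) / (d - k) + (d - (k + 1)) / (k + 2) ≤ 2 := by
    rw [div_add_div _ _ hd.ne' hk2.ne', div_le_iff₀ (by positivity)]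
    nlinarith
  have e4 : (0 : ℝ) ≤ d.choose (k + 1) := by positivity
  rw [e1, e2, mul_div_assoc, mul_div_assoc, ← mul_add]
  nlinarith

theorem exp_neg_le_div {x : ℝ} (hx : 0 ≤ x) (hx' : x ≤ 1 / 20) :
    Real.exp (-(2 * 1.003 * x)) ≤ (1 - x) / (1 + x) := by
  have h := Real.quadratic_le_exp_of_nonneg (show 0 ≤ 2 * 1.003 * x by positivity)
  rw [Real.exp_neg, inv_le_comm₀ (Real.exp_pos _) (by apply div_pos <;> linarith), inv_div]
  refine le_trans ?_ h
  rw [div_le_iff₀ (by linarith)]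
  nlinarith [mul_nonneg hx (sub_nonneg.2 hx'), mul_nonneg (mul_nonneg hx hx) (sub_nonneg.2 hx')]

/-- A Gaussian lower bound for binomial coefficients near the middle. -/
theorem choose_mul_exp_le {d h : ℕ} (hh : d ≤ 2 * h) (i : ℕ)
    (hi : 20 * (2 * (h + i : ℝ) - d) ≤ d) :
    (d.choose h : ℝ) * Real.exp (-(1.003 * (2 * (h + i : ℝ) - d) ^ 2 / (2 * (d + 1)))) ≤
      d.choose (h + i) := by
  have hh' : (d : ℝ) ≤ 2 * h := by exact_mod_cast hh
  induction i with
  | zero =>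
    refine mul_le_of_le_one_right (by positivity) (Real.exp_le_one_iff.2 ?_)
    rw [neg_nonpos]; positivity
  | succ i ih =>
    push_cast at hi
    have h1 := ih (by linarith)
    have hd : (0 : ℝ) < d + 1 := by positivity
    have hid : (h + i : ℝ) ≤ d := by linarith
    have h2 : (d.choose (h + i + 1) : ℝ) * (h + i + 1) = d.choose (h + i) * (d - (h + i)) := by
      have := Nat.choose_succ_right_eq d (h + i)
      rw [← Nat.cast_inj (R := ℝ)] at this
      push_cast [Nat.cast_sub (show h + i ≤ d by exact_mod_cast hid)] at this
      linarith
    set x : ℝ := (2 * (h + i : ℝ) + 1 - d) / (d + 1) with hx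
    have hi0 : (0 : ℝ) ≤ i := by positivity
    have h3 := exp_neg_le_div (x := x) (by apply div_nonneg <;> linarith)
      (by rw [hx, div_le_iff₀ hd]; linarith)
    have h4 : (1 - x) / (1 + x) = (d - (h + i)) / (h + i + 1) := by
      have : 1 - x = 2 * (d - (h + i)) / (d + 1) := by rw [hx]; field_simp; ring
      have h' : 1 + x = 2 * (h + i + 1) / (d + 1) := by rw [hx]; field_simp; ring
      have : (h + i + 1 : ℝ) ≠ 0 := by positivity
      rw [‹1 - x = _›, h']
      field_simp
    have h5 : (d.choose (h + i + 1) : ℝ) = d.choose (h + i) * ((1 - x) / (1 + x)) := by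
      rw [h4]; field_simp; linarith
    have h6 : -(1.003 * (2 * ((h : ℝ) + (i + 1 : ℕ)) - d) ^ 2 / (2 * (d + 1))) =
        -(1.003 * (2 * (h + i : ℝ) - d) ^ 2 / (2 * (d + 1))) + -(2 * 1.003 * x) := by
      rw [hx]; push_cast; field_simp; ring
    rw [h6, Real.exp_add, ← mul_assoc, ← add_assoc, h5]
    gcongr

theorem choose_half_sq_ge (d : ℕ) :
    2 / (Real.pi * (d + 2)) ≤ ((d.choose ((d + 1) / 2) : ℝ) / 2 ^ d) ^ 2 := by
  have W : ∀ k : ℕ, 2 / (Real.pi * (2 * k + 1)) ≤ ((Nat.centralBinom k : ℝ) / 4 ^ k) ^ 2 := by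
    intro k
    have h := Real.Wallis.W_le k
    rw [Real.Wallis.W_eq_factorial_ratio] at h
    have h1 : (Nat.centralBinom k : ℝ) = (2 * k).factorial / (k.factorial * k.factorial) := by
      rw [Nat.centralBinom, Nat.cast_choose ℝ (by omega)]
      congr 4; omega
    have p1 : (0 : ℝ) < k.factorial := by positivity
    have p2 : (0 : ℝ) < (2 * k).factorial := by positivity
    have p3 := Real.pi_pos
    rw [h1]
    rw [div_le_iff₀ (by positivity)] at h
    have h4 : ((2 : ℝ) ^ (4 * k)) = (4 ^ k) ^ 2 := by
      rw [← pow_mul, mul_comm k 2, pow_mul, pow_mul]; norm_num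
    rw [h4] at h
    rw [div_div, div_pow, div_le_div_iff₀ (by positivity) (by positivity)]
    calc _ = 2 * ((4 ^ k) ^ 2 * (k.factorial : ℝ) ^ 4) := by ring
      _ ≤ 2 * (Real.pi / 2 * ((2 * k).factorial ^ 2 * (2 * k + 1))) := by gcongr
      _ = _ := by ring
  have p3 := Real.pi_pos
  rcases Nat.even_or_odd' d with ⟨m, rfl | rfl⟩
  · have h := W m
    rw [show (2 * m + 1) / 2 = m by omega, pow_mul]
    refine le_trans ?_ (h.trans_eq ?_)
    · push_cast; gcongr; norm_num
    · rw [Nat.centralBinom]; norm_num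
  · have h := W (m + 1)
    rw [show (2 * m + 1 + 1) / 2 = m + 1 by omega]
    refine (le_of_eq ?_).trans (h.trans_eq ?_)
    · push_cast; ring
    · rw [Nat.centralBinom, show 2 * (m + 1) = 2 * m + 1 + 1 by ring, Nat.choose_succ_succ' (2 * m + 1) m,
        Nat.choose_symm_half, show (4 : ℝ) ^ (m + 1) = 2 * 2 ^ (2 * m + 1) by
          rw [pow_succ, pow_succ, pow_mul]; norm_num; ring]
      push_cast
      field_simp
      ring

theorem sum_range_choose_add_sum_range_choose (n k : ℕ) :
    ∑ i ∈ range k, n.choose i + ∑ i ∈ range (k + 1), n.choose i =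
      ∑ i ∈ range (k + 1), (n + 1).choose i := by
  rw [sum_range_succ' _ k, sum_range_succ' _ k, ← add_assoc, ← sum_add_distrib]
  simp [Nat.choose_succ_succ']

theorem two_mul_sum_range_half_choose (d : ℕ) :
    2 * ∑ i ∈ range ((d + 1) / 2), d.choose i + (1 - d % 2) * d.choose ((d + 1) / 2) = 2 ^ d := by
  rcases Nat.even_or_odd' d with ⟨m, rfl | rfl⟩
  · have h1 := sum_range_choose_add_sum_range_choose (2 * m) m
    rw [Nat.sum_range_choose_halfway, sum_range_succ] at h1
    rw [show (2 * m + 1) / 2 = m by omega, pow_mul, show (2 * m) % 2 = 0 by omega]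
    norm_num
    omega
  · rw [show (2 * m + 1 + 1) / 2 = m + 1 by omega, Nat.sum_range_choose_halfway,
      show (2 * m + 1) % 2 = 1 by omega, pow_succ, pow_mul]
    norm_num
    ring

theorem two_mul_sum_range_choose {d τ : ℕ} (hτ : (d + 1) / 2 ≤ τ) :
    2 * ∑ i ∈ range τ, d.choose i + (1 - d % 2) * d.choose ((d + 1) / 2) =
      2 ^ d + 2 * ∑ i ∈ range (τ - (d + 1) / 2), d.choose ((d + 1) / 2 + i) := by
  have h := two_mul_sum_range_half_choose d
  have h2 := sum_range_add (fun i => d.choose i) ((d + 1) / 2) (τ - (d + 1) / 2)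
  rw [Nat.add_sub_cancel' hτ] at h2
  rw [h2]
  omega

theorem cut_gain_ge_of_lt {d τ : ℕ} (hd : 2 ≤ d) (hd' : d < 625) (h1 : √(d : ℝ) ≤ 2 * (τ : ℝ) - d)
    (h2 : 2 * (τ : ℝ) - d < √(d : ℝ) + 2) :
    9 / (32 * √(d : ℝ)) ≤ (τ * d.choose τ / d / 2 ^ (d - 1)) *
      ((2 * ∑ i ∈ range τ, (d.choose i : ℝ) - 2 ^ d) / 2 ^ d) := by
  have hD2 : √(d : ℝ) ^ 2 = d := Real.sq_sqrt (by positivity)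
  have hd0 : (2 : ℝ) ≤ d := by exact_mod_cast hd
  have hD1 : 1 < √(d : ℝ) := by rw [Real.lt_sqrt] <;> linarith
  have hD25 : √(d : ℝ) < 25 := by
    rw [Real.sqrt_lt' (by norm_num)]
    have : (d : ℝ) < 625 := by exact_mod_cast hd'
    linarith
  obtain ⟨s, hs⟩ : ∃ s, 2 * τ = d + s := by
    refine Nat.exists_eq_add_of_le ?_
    have : (d : ℝ) ≤ 2 * τ := by linarith
    exact_mod_cast this
  have hsR : 2 * (τ : ℝ) - d = s := by
    have : 2 * (τ : ℝ) = d + s := by exact_mod_cast hs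
    linarith
  rw [hsR] at h1 h2
  have hs2 : 2 ≤ s := by
    have : (1 : ℝ) < s := by linarith
    exact_mod_cast this
  have hs27 : s < 27 := by
    have : (s : ℝ) < 27 := by linarith
    exact_mod_cast this
  have hs2d : d ≤ s ^ 2 := by
    have : (d : ℝ) ≤ s ^ 2 := by rw [← hD2]; gcongr
    exact_mod_cast this
  have hsd : (s - 2) ^ 2 < d := by
    have : ((s - 2 : ℕ) : ℝ) ^ 2 < d := by
      rw [Nat.cast_sub hs2, ← hD2]
      push_cast
      have : (2 : ℝ) ≤ s := by exact_mod_cast hs2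
      gcongr
      linarith
    exact_mod_cast this
  have he : (s - 2) ^ 2 + 1 + (d - ((s - 2) ^ 2 + 1)) = d := by omega
  have hlt : d - ((s - 2) ^ 2 + 1) < 4 * s := by
    obtain ⟨r, rfl⟩ := Nat.exists_eq_add_of_le hs2
    rw [show 2 + r - 2 = r by omega]
    have : (2 + r) ^ 2 = r ^ 2 + 4 * r + 4 := by ring
    omega
  have hc := cutCheck_all s hs27 _ hlt
  rw [he, if_pos ⟨hs2, hd, hs2d, by omega⟩] at hc
  have hle : (d + 1) / 2 ≤ τ := by omega
  have hh : (d + 1) / 2 ≤ d := by omega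
  rw [cutCheck, ← Nat.choose_eq_factorial_div_factorial hh, show (d + s) / 2 = τ by omega,
    chooseLoop_eq, Nat.add_sub_cancel' hle, Nat.ble_eq] at hc
  have hsum := two_mul_sum_range_choose hle
  simp only [zero_add] at hc
  rw [show 2 * ∑ i ∈ range (τ - (d + 1) / 2), d.choose ((d + 1) / 2 + i) -
    (1 - d % 2) * d.choose ((d + 1) / 2) = 2 * ∑ i ∈ range τ, d.choose i - 2 ^ d by omega] at hc
  have hge : 2 ^ d ≤ 2 * ∑ i ∈ range τ, d.choose i := by
    rw [← two_mul_sum_range_half_choose d]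
    have h3 := two_mul_sum_range_half_choose d
    have h4 : (1 - d % 2) * d.choose ((d + 1) / 2) ≤
        2 * ∑ i ∈ range (τ - (d + 1) / 2), d.choose ((d + 1) / 2 + i) := by
      have : 1 ≤ τ - (d + 1) / 2 ∨ d % 2 = 1 := by omega
      rcases this with h | h
      · have := single_le_sum (f := fun i => d.choose ((d + 1) / 2 + i)) (fun _ _ => Nat.zero_le _)
          (mem_range.2 (show 0 < τ - (d + 1) / 2 by omega))
        calc _ ≤ 1 * d.choose ((d + 1) / 2) := by gcongr; omega
          _ ≤ _ := by simp only [add_zero] at this; omega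
      · simp [h]
    omega
  set X := 2 * ∑ i ∈ range τ, d.choose i - 2 ^ d with hX
  have hXR : 2 * ∑ i ∈ range τ, (d.choose i : ℝ) - 2 ^ d = X := by
    rw [hX, Nat.cast_sub hge]; push_cast; ring
  rw [hXR]
  have hcR : (81 * d * 4 ^ (2 * d - 1) : ℝ) ≤ 1024 * (τ * d.choose τ * X) ^ 2 := by exact_mod_cast hc
  have hD0 : 0 < √(d : ℝ) := by linarith
  have h4 : (4 : ℝ) ^ (2 * d - 1) = (2 ^ (d - 1) * 2 ^ d) ^ 2 := by
    rw [← pow_add, ← pow_mul, show (4 : ℝ) = 2 ^ 2 by norm_num, ← pow_mul]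
    congr 1; omega
  have h5 : 9 * √(d : ℝ) * (2 ^ (d - 1) * 2 ^ d) ≤ 32 * (τ * d.choose τ * X) := by
    refine le_of_sq_le_sq ?_ (by positivity)
    rw [h4] at hcR
    rw [mul_pow, mul_pow, hD2, mul_pow 32]
    linarith
  rw [div_div, div_mul_div_comm, div_le_div_iff₀ (by positivity) (by positivity)]
  calc 9 * ((d : ℝ) * 2 ^ (d - 1) * 2 ^ d) = √(d : ℝ) * (9 * √(d : ℝ) * (2 ^ (d - 1) * 2 ^ d)) := by
        nth_rewrite 1 [← hD2]; ring
    _ ≤ √(d : ℝ) * (32 * (τ * d.choose τ * X)) := by gcongr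
    _ = _ := by ring

theorem sum_range_choose_ge_trapezoid {d τ : ℕ} (hτd : τ ≤ d) (h0 : (d : ℝ) ≤ 2 * τ)
    (h2 : 2 * (τ : ℝ) - d < √(d : ℝ) + 2) :
    ((2 * (τ : ℝ) - d) * d.choose ((d + 1) / 2) + (2 * (τ : ℝ) - d - 2) * d.choose τ) / 2 ≤
      2 * ∑ i ∈ range τ, (d.choose i : ℝ) - 2 ^ d := by
  have hle : (d + 1) / 2 ≤ τ := by
    have : d ≤ 2 * τ := by exact_mod_cast h0
    omega
  have hsum := two_mul_sum_range_choose hle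
  have hdh : d ≤ 2 * ((d + 1) / 2) := by omega
  have hdh' : (d : ℝ) ≤ 2 * ((d + 1) / 2 : ℕ) := by exact_mod_cast hdh
  set h := (d + 1) / 2 with hh
  have hD2 : √(d : ℝ) ^ 2 = d := Real.sq_sqrt (by positivity)
  have trap := two_mul_sum_ge_of_concave (fun i => (d.choose (h + i) : ℝ)) (τ - h) (by
    intro i hi
    refine choose_concave (by omega) ?_
    have e1 : (h + i + 2 : ℝ) ≤ τ := by exact_mod_cast (show h + i + 2 ≤ τ by omega)
    push_cast
    have hi0 : (0 : ℝ) ≤ i := by positivity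
    have e2 : (2 * ((h : ℝ) + i + 1) - d) ^ 2 ≤ √(d : ℝ) ^ 2 := by
      apply pow_le_pow_left₀ <;> linarith
    linarith)
  simp only [add_zero, Nat.add_sub_cancel' hle, Nat.cast_sub hle] at trap
  have hsumR : 2 * ∑ i ∈ range τ, (d.choose i : ℝ) + ((1 - d % 2 : ℕ) : ℝ) * d.choose h =
      2 ^ d + 2 * ∑ i ∈ range (τ - h), (d.choose (h + i) : ℝ) := by exact_mod_cast hsum
  have hmono : (d.choose τ : ℝ) ≤ d.choose h := by
    have := Nat.choose_le_middle τ d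
    have h' : d.choose (d / 2) = d.choose h := by
      rcases Nat.even_or_odd' d with ⟨m, rfl | rfl⟩
      · congr 1; omega
      · rw [show (2 * m + 1) / 2 = m by omega, show h = m + 1 by omega, Nat.choose_symm_half]
    rw [h'] at this
    exact_mod_cast this
  rcases Nat.even_or_odd' d with ⟨m, hm | hm⟩
  · have hhm : (h : ℝ) = m := by exact_mod_cast (show h = m by omega)
    have hdm : (d : ℝ) = 2 * m := by exact_mod_cast hm
    rw [show d % 2 = 0 by omega] at hsumR
    rw [hhm] at trap
    push_cast at hsumR
    rw [hdm]
    linarith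
  · have hhm : (h : ℝ) = m + 1 := by exact_mod_cast (show h = m + 1 by omega)
    have hdm : (d : ℝ) = 2 * m + 1 := by exact_mod_cast hm
    rw [show d % 2 = 1 by omega] at hsumR
    rw [hhm] at trap
    push_cast at hsumR
    rw [hdm]
    linarith

theorem gaussian_trapezoid_ge {D s : ℝ} (hD : 25 ≤ D) (h1 : D ≤ s) (h2 : s < D + 2) {ρ : ℝ}
    (hρ : Real.exp (-(1.003 * s ^ 2 / (2 * (D ^ 2 + 1)))) ≤ ρ) :
    9 * Real.pi / 32 * D ≤ ρ * (s + (s - 2) * ρ) := by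
  set v := s / D - 1 with hv
  have hD0 : 0 < D := by linarith
  have hs : s = D * (1 + v) := by rw [hv]; field_simp; ring
  have hv0 : 0 ≤ v := by rw [hv, sub_nonneg, one_le_div hD0]; exact h1
  have hv1 : v ≤ 0.08 := by
    rw [hv, sub_le_iff_le_add, div_le_iff₀ hD0]; linarith
  have e1 : (0.605 : ℝ) ≤ Real.exp (-(1.003 / 2)) := by
    have h := Real.exp_one_lt_d9
    have e3 : (0.605 : ℝ) ^ 2 ≤ Real.exp (-(1.003 / 2)) ^ 2 := by
      rw [← Real.exp_nat_mul, show ((2 : ℕ) : ℝ) * -(1.003 / 2) = -1 + -0.003 by norm_num,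
        Real.exp_add, Real.exp_neg 1]
      have h3 := Real.add_one_le_exp (-0.003 : ℝ)
      have h4 : (2.7182818286 : ℝ)⁻¹ ≤ (Real.exp 1)⁻¹ := by gcongr
      calc (0.605 : ℝ) ^ 2 ≤ (2.7182818286 : ℝ)⁻¹ * (-0.003 + 1) := by norm_num
        _ ≤ _ := by gcongr
    exact le_of_sq_le_sq e3 (Real.exp_pos _).le
  have e2 : 0.605 - 0.636 * v ≤ ρ := by
    refine le_trans ?_ hρ
    have hle : 1.003 * s ^ 2 / (2 * (D ^ 2 + 1)) ≤ 1.003 / 2 + 1.003 * (v + v ^ 2 / 2) := by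
      rw [div_le_iff₀ (by positivity), hs]
      nlinarith [sq_nonneg (1 + v)]
    have h3 := Real.add_one_le_exp (-(1.003 * (v + v ^ 2 / 2)))
    calc 0.605 - 0.636 * v ≤ 0.605 * (-(1.003 * (v + v ^ 2 / 2)) + 1) := by nlinarith
      _ ≤ Real.exp (-(1.003 / 2)) * Real.exp (-(1.003 * (v + v ^ 2 / 2))) := by
        gcongr
        nlinarith
      _ = Real.exp (-(1.003 / 2 + 1.003 * (v + v ^ 2 / 2))) := by rw [← Real.exp_add]; ring_nf
      _ ≤ _ := by gcongr
  have hpi := Real.pi_lt_d4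
  have hr0 : 0 < 0.605 - 0.636 * v := by linarith
  set r := 0.605 - 0.636 * v with hr
  calc 9 * Real.pi / 32 * D ≤ 0.884 * D := by gcongr; linarith
    _ ≤ (r * ((1 + v) + (0.92 + v) * r)) * D := by
      gcongr
      rw [hr]
      nlinarith [mul_nonneg hv0 (sub_nonneg.2 hv1),
        mul_nonneg (mul_nonneg hv0 hv0) (sub_nonneg.2 hv1)]
    _ = r * (D * (1 + v) + (D * (1 + v) - 0.08 * D) * r) := by ring
    _ ≤ ρ * (s + (s - 2) * ρ) := by
      rw [← hs]
      have hs2 : 2 ≤ 0.08 * D := by linarith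
      have hs0 : 0 ≤ s - 2 := by linarith
      have hρ0 : 0 ≤ ρ := hr0.le.trans e2
      have hs1 : 0 ≤ s + (s - 0.08 * D) * r :=
        add_nonneg (by linarith) (mul_nonneg (by linarith) hr0.le)
      gcongr

theorem cut_gain_ge_of_ge {d τ : ℕ} (hd : 625 ≤ d) (h1 : √(d : ℝ) ≤ 2 * (τ : ℝ) - d)
    (h2 : 2 * (τ : ℝ) - d < √(d : ℝ) + 2) :
    9 / (32 * √(d : ℝ)) ≤ (τ * d.choose τ / d / 2 ^ (d - 1)) *
      ((2 * ∑ i ∈ range τ, (d.choose i : ℝ) - 2 ^ d) / 2 ^ d) := by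
  have hD2 : √(d : ℝ) ^ 2 = d := Real.sq_sqrt (by positivity)
  have hdR : (625 : ℝ) ≤ d := by exact_mod_cast hd
  have hD : 25 ≤ √(d : ℝ) := by rw [Real.le_sqrt] <;> linarith
  have hτd : τ ≤ d := by
    have : (τ : ℝ) ≤ d := by nlinarith
    exact_mod_cast this
  have trap := sum_range_choose_ge_trapezoid hτd (by linarith) h2
  have hdh : d ≤ 2 * ((d + 1) / 2) := by omega
  have hle : (d + 1) / 2 ≤ τ := by
    have : (d : ℝ) ≤ 2 * τ := by linarith
    have : d ≤ 2 * τ := by exact_mod_cast this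
    omega
  have gauss := choose_mul_exp_le hdh (τ - (d + 1) / 2) (by
    rw [← Nat.cast_add, Nat.add_sub_cancel' hle]
    nlinarith)
  rw [← Nat.cast_add, Nat.add_sub_cancel' hle] at gauss
  have central := choose_half_sq_ge d
  set s := 2 * (τ : ℝ) - d with hs
  have main := gaussian_trapezoid_ge hD h1 h2 (ρ := Real.exp (-(1.003 * s ^ 2 / (2 * (d + 1)))))
    (by rw [hD2])
  set ρ := Real.exp (-(1.003 * s ^ 2 / (2 * (d + 1))))
  have hρ : 0 < ρ := Real.exp_pos _
  set F := (d.choose ((d + 1) / 2) : ℝ)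
  set T := (d.choose τ : ℝ)
  set X := 2 * ∑ i ∈ range τ, (d.choose i : ℝ) - 2 ^ d
  have hX : F * (s + (s - 2) * ρ) / 2 ≤ X := by
    refine le_trans ?_ trap
    nlinarith
  have hF : 0 ≤ F := by positivity
  have hpi := Real.pi_pos
  have hτs : (τ : ℝ) = (d + s) / 2 := by rw [hs]; ring
  have h2d : (2 : ℝ) ^ d = 2 * 2 ^ (d - 1) := by
    rw [← pow_succ']; congr 1; omega
  calc 9 / (32 * √(d : ℝ)) = (9 * Real.pi / 32 * √(d : ℝ)) / (Real.pi * d) := by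
        nth_rewrite 3 [← hD2]; field_simp
    _ ≤ (ρ * (s + (s - 2) * ρ)) / (Real.pi * d) := by gcongr
    _ = (d + 2) * (ρ * (s + (s - 2) * ρ)) / (2 * d) * (2 / (Real.pi * (d + 2))) := by
        field_simp
    _ ≤ (d + s) * (ρ * (s + (s - 2) * ρ)) / (2 * d) * (F / 2 ^ d) ^ 2 := by
        have : 0 ≤ s - 2 := by linarith
        have : 0 ≤ s := by linarith
        gcongr
        linarith
    _ = (τ * (F * ρ) / d / 2 ^ (d - 1)) * ((F * (s + (s - 2) * ρ) / 2) / 2 ^ d) := by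
        rw [hτs, h2d]; field_simp
    _ ≤ _ := by
        have : 0 ≤ s - 2 := by linarith
        have : 0 ≤ s := by linarith
        gcongr

theorem cut_gain_ge {d τ : ℕ} (hd : 2 ≤ d) (hτ : τ = ⌈((d : ℝ) + √(d : ℝ)) / 2⌉₊) :
    9 / (32 * √(d : ℝ)) ≤ (((d - 1).choose (τ - 1) : ℝ) / 2 ^ (d - 1)) *
      ((2 * ∑ i ∈ range τ, (d.choose i : ℝ) - 2 ^ d) / 2 ^ d) := by
  have hl := Nat.le_ceil (((d : ℝ) + √(d : ℝ)) / 2)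
  have hu := Nat.ceil_lt_add_one (show 0 ≤ ((d : ℝ) + √(d : ℝ)) / 2 by positivity)
  rw [← hτ] at hl hu
  have hd0 : (0 : ℝ) < d := by exact_mod_cast (show 0 < d by omega)
  have hD0 : 0 < √(d : ℝ) := Real.sqrt_pos.2 hd0
  have hτ0 : 0 < τ := by
    have : (0 : ℝ) < τ := by linarith
    exact_mod_cast this
  have e : ((d - 1).choose (τ - 1) : ℝ) = τ * d.choose τ / d := by
    have h := Nat.add_one_mul_choose_eq (d - 1) (τ - 1)
    rw [Nat.sub_add_cancel (by omega), Nat.sub_add_cancel hτ0] at h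
    rw [eq_div_iff hd0.ne']
    have h' : (d : ℝ) * (d - 1).choose (τ - 1) = d.choose τ * τ := by exact_mod_cast h
    linarith
  rw [e]
  rcases lt_or_ge d 625 with h | h
  · exact cut_gain_ge_of_lt hd h (by linarith) (by linarith)
  · exact cut_gain_ge_of_ge h (by linarith) (by linarith)

theorem two_mul_sum_cuts {V : Type*} [Fintype V] [DecidableEq V] (a : V)
    (F : (V → Bool) → ℝ) :
    2 * ∑ c, F c = ∑ c, (F c + F (Function.update c a (!c a))) := by
  have hinv : Function.Involutive (fun c : V → Bool => Function.update c a (!c a)) := by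
    intro c
    simp
  have h := Equiv.sum_comp hinv.toPerm F
  simp only [Function.Involutive.coe_toPerm] at h
  rw [sum_add_distrib, h, two_mul]

theorem two_pow_card_mul_sum_cuts {V : Type*} [Fintype V] [DecidableEq V] (S : Finset V)
    (β : (V → Bool) → Bool) (Φ : (V → Bool) → ℕ → ℝ)
    (hβ : ∀ a ∈ S, ∀ c : V → Bool, β (Function.update c a (!c a)) = β c)
    (hΦ : ∀ a ∈ S, ∀ c : V → Bool, Φ (Function.update c a (!c a)) = Φ c) :
    2 ^ #S * ∑ c, Φ c #{y ∈ S | c y = β c} = ∑ c, ∑ T ∈ S.powerset, Φ c #T := by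
  induction S using Finset.induction_on generalizing Φ with
  | empty => simp
  | insert a S ha ih =>
    have hS : ∀ c : V → Bool, #{y ∈ S | Function.update c a (!c a) y = β c} =
        #{y ∈ S | c y = β c} := by
      intro c
      congr 1
      refine filter_congr fun y hy => ?_
      rw [Function.update_of_ne (by rintro rfl; exact ha hy)]
    have hstep : ∀ c : V → Bool,
        Φ c #{y ∈ insert a S | c y = β c} + Φ c #{y ∈ insert a S |
          Function.update c a (!c a) y = β c} =
        Φ c #{y ∈ S | c y = β c} + Φ c (#{y ∈ S | c y = β c} + 1) := by
      intro c
      rw [filter_insert, filter_insert, Function.update_self]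
      by_cases h : c a = β c
      · have h' : ¬ (!c a) = β c := by rw [← h]; simp
        rw [if_pos h, if_neg h', hS, card_insert_of_notMem (by simp [ha]), add_comm]
      · have h' : (!c a) = β c := by
          revert h; cases c a <;> cases β c <;> simp
        rw [if_neg h, if_pos h', card_insert_of_notMem (by simp [ha]), hS]
    have h := two_mul_sum_cuts a (fun c => Φ c #{y ∈ insert a S | c y = β c})
    simp only [hβ a (mem_insert_self a S), hΦ a (mem_insert_self a S), hstep] at h
    rw [card_insert_of_notMem ha, pow_succ, mul_assoc, h,
      ih (fun c k => Φ c k + Φ c (k + 1)) (fun b hb => hβ b (mem_insert_of_mem hb))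
        (fun b hb c => by simp only [hΦ b (mem_insert_of_mem hb)])]
    refine sum_congr rfl fun c _ => ?_
    rw [sum_powerset_insert ha, sum_add_distrib]
    congr 1
    refine sum_congr rfl fun T hT => ?_
    rw [card_insert_of_notMem fun h => ha (mem_powerset.1 hT h)]

theorem sum_powerset_card_lt {α : Type*} (S : Finset α) (k : ℕ) :
    ∑ T ∈ S.powerset, (if #T < k then (1 : ℝ) else 0) = ∑ i ∈ range k, ((#S).choose i : ℝ) := by
  rw [sum_powerset_apply_card (fun j => if j < k then (1 : ℝ) else 0)]
  simp only [nsmul_eq_mul, mul_ite, mul_one, mul_zero]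
  rw [← sum_filter]
  have : ∀ i ∈ range k, i ∉ (range (#S + 1)).filter (· < k) → ((#S).choose i : ℝ) = 0 := by
    intro i hi hi'
    simp only [mem_filter, mem_range] at hi hi'
    rw [Nat.choose_eq_zero_of_lt (by omega), Nat.cast_zero]
  exact sum_subset (fun i hi => by simp_all) this

theorem sum_sum_ne_indicator {α : Type*} (A B : Finset α) (p q : α → Prop) [DecidablePred p]
    [DecidablePred q] :
    ∑ S ∈ A, ∑ T ∈ B, (if (p S ↔ q T) then (0 : ℝ) else 1) =
      #B * (∑ S ∈ A, if p S then (1 : ℝ) else 0) + #A * (∑ T ∈ B, if q T then (1 : ℝ) else 0) -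
        2 * ((∑ S ∈ A, if p S then (1 : ℝ) else 0) * ∑ T ∈ B, if q T then (1 : ℝ) else 0) := by
  have h : ∀ S T, (if (p S ↔ q T) then (0 : ℝ) else 1) =
      (if p S then (1 : ℝ) else 0) + (if q T then (1 : ℝ) else 0) -
        2 * ((if p S then (1 : ℝ) else 0) * if q T then (1 : ℝ) else 0) := by
    intro S T
    by_cases hp : p S <;> by_cases hq : q T <;> simp [hp, hq]; norm_num
  simp only [h, sum_sub_distrib, sum_add_distrib, ← mul_sum, ← sum_mul, sum_const, nsmul_eq_mul]

/-- The exact probability that the threshold algorithm, run on a uniformly random cut, separates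
the endpoints of a given edge. -/
theorem sum_cuts_edge {V : Type*} [Fintype V] [DecidableEq V] {d τ : ℕ} (hd : 1 ≤ d) (hτ : 1 ≤ τ)
    (G : SimpleGraph V) [DecidableRel G.Adj] (hreg : G.IsRegularOfDegree d) (htf : G.CliqueFree 3)
    {u v : V} (huv : G.Adj u v) (out : (V → Bool) → V → Bool)
    (hout : ∀ c x, out c x = if #{y ∈ G.neighborFinset x | c y = c x} < τ then c x else !c x) :
    (∑ c : V → Bool, if out c u = out c v then (0 : ℝ) else 1) / 2 ^ Fintype.card V =
      1 / 2 + ((d - 1).choose (τ - 1) : ℝ) / 2 ^ (d - 1) *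
        ((2 * ∑ i ∈ range τ, (d.choose i : ℝ) - 2 ^ d) / 2 ^ d) := by
  set A := (G.neighborFinset u).erase v with hA
  set B := (G.neighborFinset v).erase u with hB
  have hne : u ≠ v := huv.ne
  have hvA : v ∉ A := notMem_erase v _
  have huB : u ∉ B := notMem_erase u _
  have huA : u ∉ A := by simp [hA]
  have hvB : v ∉ B := by simp [hB]
  have hAB : ∀ a ∈ A, a ∉ B := by
    intro a ha hb
    simp only [hA, hB, mem_erase, SimpleGraph.mem_neighborFinset] at ha hb
    exact htf {u, v, a} (SimpleGraph.is3Clique_triple_iff.2 ⟨huv, ha.2, hb.2⟩)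
  have hinsA : insert v A = G.neighborFinset u := insert_erase (by simpa using huv)
  have hinsB : insert u B = G.neighborFinset v := insert_erase (by simpa using huv.symm)
  have hcA : #A = d - 1 := by
    rw [hA, card_erase_of_mem (by simpa using huv), SimpleGraph.card_neighborFinset_eq_degree,
      hreg u]
  have hcB : #B = d - 1 := by
    rw [hB, card_erase_of_mem (by simpa using huv.symm),
      SimpleGraph.card_neighborFinset_eq_degree, hreg v]
  have hlu : ∀ c : V → Bool, #{y ∈ G.neighborFinset u | c y = c u} =
      #{y ∈ A | c y = c u} + (c u == c v).toNat := by
    intro c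
    rw [← hinsA, filter_insert]
    by_cases h : c v = c u
    · rw [if_pos h, card_insert_of_notMem (by simp [hvA]), h]; simp
    · rw [if_neg h, beq_false_of_ne (Ne.symm h)]; simp
  have hlv : ∀ c : V → Bool, #{y ∈ G.neighborFinset v | c y = c v} =
      #{y ∈ B | c y = c v} + (c u == c v).toNat := by
    intro c
    rw [← hinsB, filter_insert]
    by_cases h : c u = c v
    · rw [if_pos h, card_insert_of_notMem (by simp [huB]), h]; simp
    · rw [if_neg h, beq_false_of_ne h]; simp
  let F : Bool → ℕ → ℕ → ℝ := fun b j k =>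
    if (j + b.toNat < τ ↔ k + b.toNat < τ) then (if b then 0 else 1) else (if b then 1 else 0)
  have hF : ∀ c : V → Bool, (if out c u = out c v then (0 : ℝ) else 1) =
      F (c u == c v) #{y ∈ A | c y = c u} #{y ∈ B | c y = c v} := by
    intro c
    rw [hout, hout, hlu, hlv]
    simp only [F]
    generalize #{y ∈ A | c y = c u} + (c u == c v).toNat = j
    generalize #{y ∈ B | c y = c v} + (c u == c v).toNat = k
    cases c u <;> cases c v <;> by_cases hj : j < τ <;> by_cases hk : k < τ <;> simp [hj, hk]
  have hupd : ∀ a, a ≠ u → a ≠ v → ∀ c : V → Bool,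
      Function.update c a (!c a) u = c u ∧ Function.update c a (!c a) v = c v :=
    fun a h1 h2 c => ⟨Function.update_of_ne h1.symm _ _, Function.update_of_ne h2.symm _ _⟩
  have step1 := two_pow_card_mul_sum_cuts A (fun c => c u)
    (fun c j => F (c u == c v) j #{y ∈ B | c y = c v})
    (fun a ha c => (hupd a (by rintro rfl; exact huA ha) (by rintro rfl; exact hvA ha) c).1)
    (fun a ha c => by
      obtain ⟨h1, h2⟩ := hupd a (by rintro rfl; exact huA ha) (by rintro rfl; exact hvA ha) c
      simp only [h1, h2]
      rw [filter_congr (q := fun y => c y = c v) fun y hy => by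
        rw [Function.update_of_ne (by rintro rfl; exact hAB _ ha hy)]])
  have step2 := two_pow_card_mul_sum_cuts B (fun c => c v)
    (fun c k => ∑ T ∈ A.powerset, F (c u == c v) #T k)
    (fun a ha c => (hupd a (by rintro rfl; exact huB ha) (by rintro rfl; exact hvB ha) c).2)
    (fun a ha c => by
      obtain ⟨h1, h2⟩ := hupd a (by rintro rfl; exact huB ha) (by rintro rfl; exact hvB ha) c
      simp only [h1, h2])
  have step3 := two_mul_sum_cuts u
    (fun c => ∑ T' ∈ B.powerset, ∑ T ∈ A.powerset, F (c u == c v) #T #T')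
  simp only [Function.update_self, Function.update_of_ne hne.symm] at step3
  set x₀ : ℝ := ∑ i ∈ range τ, ((d - 1).choose i : ℝ) with hx₀
  set x₁ : ℝ := ∑ i ∈ range (τ - 1), ((d - 1).choose i : ℝ) with hx₁
  have cardA : (#A.powerset : ℝ) = 2 ^ (d - 1) := by rw [card_powerset, hcA]; norm_num
  have cardB : (#B.powerset : ℝ) = 2 ^ (d - 1) := by rw [card_powerset, hcB]; norm_num
  have lt_iff : ∀ j, j + 1 < τ ↔ j < τ - 1 := fun j => by omega
  have hT : ∑ T' ∈ B.powerset, ∑ T ∈ A.powerset, F true #T #T' =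
      2 * 2 ^ (d - 1) * x₁ - 2 * x₁ ^ 2 := by
    have h := sum_sum_ne_indicator B.powerset A.powerset (fun T => #T < τ - 1) (fun T => #T < τ - 1)
    rw [sum_powerset_card_lt, sum_powerset_card_lt, hcA, hcB, cardA, cardB] at h
    simp only [F, Bool.toNat_true, lt_iff, if_true]
    simp only [iff_comm] at h ⊢
    rw [h]; ring
  have hFf : ∑ T' ∈ B.powerset, ∑ T ∈ A.powerset, F false #T #T' =
      2 ^ (d - 1) * 2 ^ (d - 1) - (2 * 2 ^ (d - 1) * x₀ - 2 * x₀ ^ 2) := by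
    have h := sum_sum_ne_indicator B.powerset A.powerset (fun T => #T < τ) (fun T => #T < τ)
    rw [sum_powerset_card_lt, sum_powerset_card_lt, hcA, hcB, cardA, cardB] at h
    have h' : ∀ j k, F false j k = 1 - (if (k < τ ↔ j < τ) then (0 : ℝ) else 1) := by
      intro j k
      simp only [F, Bool.toNat_false, add_zero, iff_comm (a := k < τ)]
      split_ifs <;> simp_all
    simp only [h', sum_sub_distrib, sum_const, nsmul_eq_mul, mul_one, cardA, cardB]
    rw [h]; ring
  have hsum : ∀ c : V → Bool,
      (∑ T' ∈ B.powerset, ∑ T ∈ A.powerset, F (c u == c v) #T #T') +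
        (∑ T' ∈ B.powerset, ∑ T ∈ A.powerset, F ((!c u) == c v) #T #T') =
      (2 * 2 ^ (d - 1) * x₁ - 2 * x₁ ^ 2) +
        (2 ^ (d - 1) * 2 ^ (d - 1) - (2 * 2 ^ (d - 1) * x₀ - 2 * x₀ ^ 2)) := by
    intro c
    rw [← hT, ← hFf]
    cases c u <;> cases c v <;> simp [add_comm]
  simp only [hsum, sum_const, card_univ, Fintype.card_fun, Fintype.card_bool, nsmul_eq_mul] at step3
  rw [← step2] at step3
  have swap : ∑ c : V → Bool, ∑ T ∈ A.powerset, F (c u == c v) #T #{y ∈ B | c y = c v} =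
      2 ^ #A * ∑ c : V → Bool, (if out c u = out c v then (0 : ℝ) else 1) := by
    simp only [hF]
    exact step1.symm
  rw [swap, hcA, hcB] at step3
  push_cast at step3
  have hx : x₀ = x₁ + ((d - 1).choose (τ - 1) : ℝ) := by
    rw [hx₀, hx₁, ← sum_range_succ, Nat.sub_add_cancel hτ]
  have hpascal : x₁ + x₀ = ∑ i ∈ range τ, (d.choose i : ℝ) := by
    have h := sum_range_choose_add_sum_range_choose (d - 1) (τ - 1)
    rw [Nat.sub_add_cancel hτ, Nat.sub_add_cancel hd] at h
    rw [hx₀, hx₁]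
    exact_mod_cast h
  rw [← hpascal]
  have h2d : (2 : ℝ) ^ d = 2 * 2 ^ (d - 1) := by
    rw [← pow_succ']; congr 1; omega
  rw [h2d]
  have hC : ((d - 1).choose (τ - 1) : ℝ) = x₀ - x₁ := by rw [hx]; ring
  rw [hC]
  have hN : (0 : ℝ) < 2 ^ (d - 1) := by positivity
  set N : ℝ := 2 ^ (d - 1)
  rw [div_eq_iff (by positivity)]
  have hNN : (2 * (N * N)) ≠ 0 := by positivity
  apply mul_left_cancel₀ hNN
  rw [show ∀ S : ℝ, 2 * (N * N) * S = 2 * (N * (N * S)) from fun S => by ring, step3]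
  field_simp
  ring

end

theorem stmt4 {V : Type*} [Fintype V] [DecidableEq V]
    (d : ℕ) (hd : 2 ≤ d) (τ : ℕ) (hτ : τ = ⌈((d : ℝ) + Real.sqrt d) / 2⌉₊)
    (G : SimpleGraph V) [DecidableRel G.Adj]
    (hreg : G.IsRegularOfDegree d) (htf : G.CliqueFree 3) :
    (∑ c : V → Bool,
      ((G.edgeFinset.filter (fun e =>
        ¬ (e.map (fun x =>
          if ((G.neighborFinset x).filter (fun y => c y = c x)).card < τ
          then c x else !(c x))).IsDiag)).card : ℝ))
      / 2 ^ (Fintype.card V)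
    ≥ (1/2 + 9 / (32 * Real.sqrt d)) * G.edgeFinset.card := by
  have hτ1 : 1 ≤ τ := by
    rw [hτ, Nat.one_le_ceil_iff]
    have : (0 : ℝ) < d := by exact_mod_cast (show 0 < d by omega)
    positivity
  simp only [Finset.natCast_card_filter]
  rw [Finset.sum_comm, Finset.sum_div, ge_iff_le, mul_comm, ← nsmul_eq_mul]
  refine Finset.card_nsmul_le_sum _ _ _ fun e he => ?_
  induction e using Sym2.ind with
  | _ u v =>
    have huv : G.Adj u v := by simpa using he
    have h := sum_cuts_edge (by omega : 1 ≤ d) hτ1 G hreg htf huv _ (fun _ _ => rfl)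
    simp only [Sym2.map_mk, Sym2.mk_isDiag_iff, ite_not]
    rw [h]
    have := cut_gain_ge hd hτ
    linarith
end

section
/- Let d ≥ 2 be an integer and let G be a d-regular triangle-free simple graph on a finite vertex set V with edge set E. Then there exists a cut c : V → {a,b} such that the number of edges {u,v} ∈ E with c(u) ≠ c(v) is at least (1/2 + 9/(32·√d)) · |E|. -/
open MeasureTheory ProbabilityTheory Real
open scoped RealInnerProductSpace

/-- The sign of a real number, with the value `-1` at zero. -/
noncomputable def signPM (t : ℝ) : ℝ := if 0 < t then 1 else -1

lemma signPM_of_pos {t : ℝ} (h : 0 < t) : signPM t = 1 := if_pos h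

lemma signPM_of_neg {t : ℝ} (h : t < 0) : signPM t = -1 := if_neg h.not_gt

lemma signPM_mul_pos {r : ℝ} (hr : 0 < r) (t : ℝ) : signPM (r * t) = signPM t := by
  simp only [signPM, mul_pos_iff_of_pos_left hr]

@[fun_prop]
lemma measurable_signPM : Measurable signPM :=
  Measurable.ite measurableSet_Ioi measurable_const measurable_const

lemma norm_signPM (t : ℝ) : ‖signPM t‖ = 1 := by
  unfold signPM; split_ifs <;> simp

lemma norm_signPM_mul_le (s t : ℝ) : ‖signPM s * signPM t‖ ≤ 1 := by
  rw [norm_mul, norm_signPM, norm_signPM, one_mul]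

lemma integrable_signPM_mul {Ω : Type*} [MeasurableSpace Ω] {μ : Measure Ω} [IsFiniteMeasure μ]
    {f g : Ω → ℝ} (hf : Measurable f) (hg : Measurable g) :
    Integrable (fun x ↦ signPM (f x) * signPM (g x)) μ :=
  Integrable.of_bound (Measurable.aestronglyMeasurable (by fun_prop)) 1
    (.of_forall fun _ ↦ norm_signPM_mul_le _ _)

lemma intervalIntegral_eq_of_eq_const_on_Ioo {f : ℝ → ℝ} {a b c : ℝ} (hab : a ≤ b)
    (h : ∀ x ∈ Set.Ioo a b, f x = c) : ∫ x in a..b, f x = c * (b - a) := by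
  rw [intervalIntegral.integral_of_le hab, integral_Ioc_eq_integral_Ioo,
    setIntegral_congr_fun measurableSet_Ioo h]
  simp [hab, mul_comm]

lemma integral_signPM_cos_mul_signPM_sin {a : ℝ} (ha : -(π / 2) ≤ a) (ha' : a ≤ π / 2) :
    ∫ t in -(π / 2)..-(π / 2) + 2 * π, signPM (cos t) * signPM (sin (t + a)) = 4 * a := by
  have hπ := pi_pos
  have hint : ∀ x y : ℝ, IntervalIntegrable (fun t ↦ signPM (cos t) * signPM (sin (t + a)))
      volume x y := fun x y ↦
    ⟨integrable_signPM_mul (by fun_prop) (by fun_prop),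
      integrable_signPM_mul (by fun_prop) (by fun_prop)⟩
  have h₁ : ∫ t in -(π / 2)..-a, signPM (cos t) * signPM (sin (t + a))
      = -1 * (-a - -(π / 2)) := by
    refine intervalIntegral_eq_of_eq_const_on_Ioo (by linarith) fun t ⟨h, h'⟩ ↦ ?_
    rw [signPM_of_pos (cos_pos_of_mem_Ioo ⟨by linarith, by linarith⟩),
      signPM_of_neg (sin_neg_of_neg_of_neg_pi_lt (by linarith) (by linarith)), one_mul]
  have h₂ : ∫ t in -a..π / 2, signPM (cos t) * signPM (sin (t + a)) = 1 * (π / 2 - -a) := by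
    refine intervalIntegral_eq_of_eq_const_on_Ioo (by linarith) fun t ⟨h, h'⟩ ↦ ?_
    rw [signPM_of_pos (cos_pos_of_mem_Ioo ⟨by linarith, by linarith⟩),
      signPM_of_pos (sin_pos_of_pos_of_lt_pi (by linarith) (by linarith)), one_mul]
  have h₃ : ∫ t in π / 2..π - a, signPM (cos t) * signPM (sin (t + a))
      = -1 * (π - a - π / 2) := by
    refine intervalIntegral_eq_of_eq_const_on_Ioo (by linarith) fun t ⟨h, h'⟩ ↦ ?_
    rw [signPM_of_neg (cos_neg_of_pi_div_two_lt_of_lt (by linarith) (by linarith)),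
      signPM_of_pos (sin_pos_of_pos_of_lt_pi (by linarith) (by linarith)), mul_one]
  have h₄ : ∫ t in π - a..-(π / 2) + 2 * π, signPM (cos t) * signPM (sin (t + a))
      = 1 * (-(π / 2) + 2 * π - (π - a)) := by
    refine intervalIntegral_eq_of_eq_const_on_Ioo (by linarith) fun t ⟨h, h'⟩ ↦ ?_
    have hs : sin (t + a) = sin (t + a - 2 * π) := (sin_sub_two_pi _).symm
    rw [signPM_of_neg (cos_neg_of_pi_div_two_lt_of_lt (by linarith) (by linarith)), hs,
      signPM_of_neg (sin_neg_of_neg_of_neg_pi_lt (by linarith) (by linarith))]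
    norm_num
  rw [← intervalIntegral.integral_add_adjacent_intervals (hint _ (π - a)) (hint _ _),
    ← intervalIntegral.integral_add_adjacent_intervals (hint _ (π / 2)) (hint _ _),
    ← intervalIntegral.integral_add_adjacent_intervals (hint _ (-a)) (hint _ _), h₁, h₂, h₃, h₄]
  ring

lemma integral_signPM_rotation {a : ℝ} (ha : -(π / 2) ≤ a) (ha' : a ≤ π / 2) {z : ℂ} (hz : z ≠ 0) :
    ∫ t in 0..2 * π, signPM (cos t * z.re - sin t * z.im) *
      signPM (sin (t + a) * z.re + cos (t + a) * z.im) = 4 * a := by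
  have hr : 0 < ‖z‖ := norm_pos_iff.2 hz
  set H : ℝ → ℝ := fun t ↦ signPM (cos t) * signPM (sin (t + a)) with hH
  have hper : Function.Periodic H (2 * π) := fun t ↦ by
    simp only [hH, cos_add_two_pi, add_right_comm t (2 * π) a, sin_add_two_pi]
  have hre : z.re = ‖z‖ * cos z.arg := (Complex.norm_mul_cos_arg z).symm
  have him : z.im = ‖z‖ * sin z.arg := (Complex.norm_mul_sin_arg z).symm
  have hcongr : ∀ t, signPM (cos t * z.re - sin t * z.im) *
      signPM (sin (t + a) * z.re + cos (t + a) * z.im) = H (t + z.arg) := fun t ↦ by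
    simp only [hH]
    rw [← signPM_mul_pos hr (cos _), ← signPM_mul_pos hr (sin _), cos_add t z.arg,
      add_right_comm t, sin_add (t + a) z.arg]
    congr 2
    · linear_combination cos t * hre - sin t * him
    · linear_combination sin (t + a) * hre + cos (t + a) * him
  simp_rw [hcongr]
  rw [intervalIntegral.integral_comp_add_right H, zero_add, add_comm (2 * π),
    hper.intervalIntegral_add_eq _ (-(π / 2))]
  exact integral_signPM_cos_mul_signPM_sin ha ha'

section Gaussian

variable {E : Type*} [NormedAddCommGroup E] [InnerProductSpace ℝ E] [FiniteDimensional ℝ E]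
  [MeasurableSpace E] [BorelSpace E]

lemma stdGaussian_inner_ne_zero {u : E} (hu : u ≠ 0) : ∀ᵐ x ∂stdGaussian E, ⟪u, x⟫ ≠ 0 := by
  have hmap : (stdGaussian E).map (innerSL ℝ u) =
      gaussianReal 0 (‖innerSL ℝ u‖ ^ 2).toNNReal := by
    rw [IsGaussian.map_eq_gaussianReal, integral_strongDual_stdGaussian,
      variance_dual_stdGaussian]
  have hvar : (‖innerSL ℝ u‖ ^ 2).toNNReal ≠ 0 := by
    simpa [innerSL_apply_norm] using hu
  have := nullSingletonClass_gaussianReal (μ := 0) hvar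
  have h0 : (stdGaussian E).map (innerSL ℝ u) {0} = 0 := by rw [hmap, measure_singleton]
  rw [Measure.map_apply (by fun_prop) (measurableSet_singleton 0)] at h0
  exact measure_eq_zero_iff_ae_notMem.1 h0

/-- The two coordinates of a standard Gaussian vector along an orthonormal pair form a standard
Gaussian vector in the plane. -/
lemma stdGaussian_map_orthonormal_pair {u w : E} (hu : ‖u‖ = 1) (hw : ‖w‖ = 1)
    (huw : ⟪u, w⟫ = 0) :
    (stdGaussian E).map (fun x ↦ (⟨⟪u, x⟫, ⟪w, x⟫⟩ : ℂ)) = stdGaussian ℂ := by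
  have hmeas : Measurable (fun x : E ↦ (⟨⟪u, x⟫, ⟪w, x⟫⟩ : ℂ)) :=
    Complex.measurableEquivRealProd.symm.measurable.comp
      (f := fun x ↦ ((⟪u, x⟫, ⟪w, x⟫) : ℝ × ℝ)) (by fun_prop)
  have := Measure.isProbabilityMeasure_map (μ := stdGaussian E) hmeas.aemeasurable
  apply Measure.ext_of_charFun
  ext t
  have h : charFun ((stdGaussian E).map (fun x ↦ (⟨⟪u, x⟫, ⟪w, x⟫⟩ : ℂ))) t =
      charFun (stdGaussian E) (t.re • u + t.im • w) := by
    rw [charFun_apply, charFun_apply, integral_map hmeas.aemeasurable (by fun_prop)]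
    refine integral_congr_ae (.of_forall fun x ↦ ?_)
    simp only [Complex.inner, inner_add_right, real_inner_smul_right, real_inner_comm x]
    simp
  have hn : ‖t.re • u + t.im • w‖ ^ 2 = ‖t‖ ^ 2 := by
    rw [norm_add_sq_real, norm_smul, norm_smul, hu, hw, real_inner_smul_left,
      real_inner_smul_right, huw, Complex.sq_norm, Complex.normSq_apply]
    simp only [norm_eq_abs, mul_one, sq_abs]
    ring
  rw [h, charFun_stdGaussian, charFun_stdGaussian]
  exact_mod_cast congrArg (fun r : ℝ ↦ Complex.exp (-(r : ℂ) / 2)) hn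

lemma integral_signPM_stdGaussian_complex {a : ℝ} (ha : -(π / 2) ≤ a) (ha' : a ≤ π / 2) :
    ∫ z, signPM z.re * signPM (sin a * z.re + cos a * z.im) ∂stdGaussian ℂ = 2 / π * a := by
  have hrot (t : ℝ) : ∫ z : ℂ, signPM (cos t * z.re - sin t * z.im) *
      signPM (sin (t + a) * z.re + cos (t + a) * z.im) ∂stdGaussian ℂ =
      ∫ z, signPM z.re * signPM (sin a * z.re + cos a * z.im) ∂stdGaussian ℂ := by
    conv_rhs => rw [← stdGaussian_map (rotation (Circle.exp t))]
    rw [integral_map (by fun_prop) (Measurable.aestronglyMeasurable (by fun_prop))]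
    refine integral_congr_ae (.of_forall fun z ↦ ?_)
    simp only [rotation_apply, Circle.coe_exp, Complex.mul_re, Complex.mul_im,
      Complex.exp_ofReal_mul_I_re, Complex.exp_ofReal_mul_I_im, sin_add, cos_add]
    congr 2
    ring
  have hae : ∀ᵐ z ∂stdGaussian ℂ, z ≠ 0 := by
    filter_upwards [stdGaussian_inner_ne_zero (one_ne_zero (α := ℂ))] with z hz h
    exact hz (by rw [h, inner_zero_right])
  have hswap : ∫ t in 0..2 * π, ∫ z : ℂ, signPM (cos t * z.re - sin t * z.im) *
      signPM (sin (t + a) * z.re + cos (t + a) * z.im) ∂stdGaussian ℂ = 4 * a := by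
    rw [intervalIntegral.integral_of_le (by positivity), integral_integral_swap]
    · rw [integral_congr_ae (g := fun _ ↦ 4 * a)]
      · simp
      · filter_upwards [hae] with z hz
        rw [← intervalIntegral.integral_of_le (by positivity), integral_signPM_rotation ha ha' hz]
    · exact integrable_signPM_mul (f := fun p : ℝ × ℂ ↦ cos p.1 * p.2.re - sin p.1 * p.2.im)
        (g := fun p : ℝ × ℂ ↦ sin (p.1 + a) * p.2.re + cos (p.1 + a) * p.2.im)
        (by fun_prop) (by fun_prop)
  simp_rw [hrot] at hswap
  rw [intervalIntegral.integral_const, smul_eq_mul] at hswap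
  have := pi_ne_zero
  field_simp
  linarith

/-- **Grothendieck's identity**. -/
lemma integral_signPM_inner_mul_signPM_inner {u v : E} (hu : ‖u‖ = 1) (hv : ‖v‖ = 1)
    (h : |⟪u, v⟫| < 1) :
    ∫ x, signPM ⟪u, x⟫ * signPM ⟪v, x⟫ ∂stdGaussian E = 2 / π * arcsin ⟪u, v⟫ := by
  set r : ℝ := ⟪u, v⟫ with hr
  obtain ⟨h₁, h₂⟩ := abs_lt.1 h
  set k : ℝ := √(1 - r ^ 2) with hk
  have hpos : 0 < 1 - r ^ 2 := by nlinarith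
  have hk0 : 0 < k := sqrt_pos.2 hpos
  have hk2 : k ^ 2 = 1 - r ^ 2 := sq_sqrt hpos.le
  set w : E := k⁻¹ • (v - r • u) with hw
  have huu : ⟪u, u⟫ = 1 := by rw [real_inner_self_eq_norm_sq, hu, one_pow]
  have hvv : ⟪v, v⟫ = 1 := by rw [real_inner_self_eq_norm_sq, hv, one_pow]
  have huw : ⟪u, w⟫ = 0 := by
    rw [hw, real_inner_smul_right, inner_sub_right, real_inner_smul_right, huu, ← hr]
    ring
  have hww : ‖w‖ = 1 := by
    have : ‖v - r • u‖ ^ 2 = k ^ 2 := by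
      rw [norm_sub_sq_real, norm_smul, hu, hv, real_inner_smul_right, real_inner_comm, ← hr, hk2,
        norm_eq_abs, mul_one, sq_abs]
      ring
    rw [hw, norm_smul, (pow_left_inj₀ (norm_nonneg _) hk0.le two_ne_zero).1 this, norm_inv,
      norm_of_nonneg hk0.le, inv_mul_cancel₀ hk0.ne']
  have hvx (x : E) : ⟪v, x⟫ = sin (arcsin r) * ⟪u, x⟫ + cos (arcsin r) * ⟪w, x⟫ := by
    rw [sin_arcsin h₁.le h₂.le, cos_arcsin, ← hk, hw, real_inner_smul_left, inner_sub_left,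
      real_inner_smul_left, mul_inv_cancel_left₀ hk0.ne']
    ring
  have hmeas : Measurable (fun x : E ↦ (⟨⟪u, x⟫, ⟪w, x⟫⟩ : ℂ)) :=
    Complex.measurableEquivRealProd.symm.measurable.comp
      (f := fun x ↦ ((⟪u, x⟫, ⟪w, x⟫) : ℝ × ℝ)) (by fun_prop)
  rw [← integral_signPM_stdGaussian_complex (neg_pi_div_two_le_arcsin r) (arcsin_le_pi_div_two r),
    ← stdGaussian_map_orthonormal_pair hu hww huw, integral_map hmeas.aemeasurable
      (Measurable.aestronglyMeasurable (by fun_prop))]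
  simp_rw [hvx]

end Gaussian

namespace SimpleGraph

variable {V : Type*} [Fintype V] (G : SimpleGraph V) [DecidableRel G.Adj]

/-- If unit vectors are assigned to the vertices so that adjacent ones have inner product `-ρ`, then
hyperplane rounding gives a cut with at least `(1 / 2 + arcsin ρ / π) * |E|` edges. -/
lemma exists_cut_of_unit_vectors {E : Type*} [NormedAddCommGroup E] [InnerProductSpace ℝ E]
    [FiniteDimensional ℝ E] [MeasurableSpace E] [BorelSpace E] (y : V → E) (hy : ∀ v, ‖y v‖ = 1)
    {ρ : ℝ} (hρ : |ρ| < 1) (hadj : ∀ u v, G.Adj u v → ⟪y u, y v⟫ = -ρ) :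
    ∃ c : V → Bool, (1 / 2 + arcsin ρ / π) * G.edgeFinset.card ≤
      ((G.edgeFinset.filter (fun e => ¬ (e.map c).IsDiag)).card : ℝ) := by
  let c (x : E) (v : V) : Bool := decide (0 < ⟪y v, x⟫)
  let f (x : E) (e : Sym2 V) : ℝ := if ¬ (e.map (c x)).IsDiag then 1 else 0
  have hf (x : E) (u v : V) : f x s(u, v) = (1 - signPM ⟪y u, x⟫ * signPM ⟪y v, x⟫) / 2 := by
    simp only [f, c, signPM, Sym2.map_mk, Sym2.mk_isDiag_iff, decide_eq_decide]
    by_cases h₁ : 0 < ⟪y u, x⟫ <;> by_cases h₂ : 0 < ⟪y v, x⟫ <;> simp [h₁, h₂]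
  have hint (u v : V) :
      Integrable (fun x ↦ signPM ⟪y u, x⟫ * signPM ⟪y v, x⟫) (stdGaussian E) :=
    integrable_signPM_mul (by fun_prop) (by fun_prop)
  have hfint (e : Sym2 V) : Integrable (fun x ↦ f x e) (stdGaussian E) := by
    induction e with | h u v =>
    simp_rw [hf]
    exact ((integrable_const 1).sub (hint u v)).div_const 2
  have hval : ∀ e ∈ G.edgeFinset, ∫ x, f x e ∂stdGaussian E = 1 / 2 + arcsin ρ / π := by
    intro e he
    induction e with | h u v =>
    rw [mem_edgeFinset, mem_edgeSet] at he
    simp_rw [hf]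
    rw [integral_div, integral_sub (integrable_const 1) (hint u v),
      integral_signPM_inner_mul_signPM_inner (hy u) (hy v) (by rwa [hadj u v he, abs_neg]),
      hadj u v he, arcsin_neg]
    simp
    ring
  obtain ⟨x, hx⟩ := exists_integral_le
    (integrable_finsetSum G.edgeFinset fun e _ ↦ hfint e)
  refine ⟨c x, ?_⟩
  rw [integral_finsetSum _ fun e _ ↦ hfint e, Finset.sum_congr rfl hval, Finset.sum_const,
    nsmul_eq_mul, mul_comm] at hx
  rwa [Finset.natCast_card_filter]

variable {G} [DecidableEq V]

lemma CliqueFree.inter_neighborFinset_eq_empty (h : G.CliqueFree 3) {u v : V} (huv : G.Adj u v) :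
    G.neighborFinset u ∩ G.neighborFinset v = ∅ := by
  ext x
  simp only [Finset.mem_inter, mem_neighborFinset, Finset.notMem_empty, iff_false, not_and]
  exact fun hux hvx ↦ h {u, v, x} (is3Clique_triple_iff.2 ⟨huv, hux, hvx⟩)

/-- In a triangle-free `d`-regular graph, the normalised vectors `e_v - d ^ (-1 / 2) ∑_{w ~ v} e_w`
are unit vectors with inner product `-d ^ (-1 / 2)` along edges. -/
lemma IsRegularOfDegree.exists_unit_vectors {d : ℕ} (hreg : G.IsRegularOfDegree d) (hd : 0 < d)
    (htf : G.CliqueFree 3) :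
    ∃ y : V → EuclideanSpace ℝ V, (∀ v, ‖y v‖ = 1) ∧
      ∀ u v, G.Adj u v → ⟪y u, y v⟫ = -(√d)⁻¹ := by
  set k : ℝ := (√d)⁻¹ with hk
  have hk2 : k ^ 2 * d = 1 := by
    rw [hk, inv_pow, sq_sqrt d.cast_nonneg, inv_mul_cancel₀ (by positivity)]
  let a (v : V) : EuclideanSpace ℝ V :=
    WithLp.toLp 2 fun x ↦ (if x = v then 1 else 0) - k * (if G.Adj v x then 1 else 0)
  have ha (u v : V) : ⟪a u, a v⟫ = (if u = v then 1 else 0) - 2 * k * (if G.Adj u v then 1 else 0)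
      + k ^ 2 * (G.neighborFinset u ∩ G.neighborFinset v).card := by
    have hcard : ((G.neighborFinset u ∩ G.neighborFinset v).card : ℝ) =
        ∑ x, (if G.Adj u x then 1 else 0) * (if G.Adj v x then 1 else 0) := by
      simp_rw [mul_ite, mul_one, mul_zero, ← ite_and]
      rw [← Finset.natCast_card_filter]
      congr 2
      ext x
      simp [and_comm]
    rw [hcard, PiLp.inner_apply]
    calc ∑ x, ⟪a u x, a v x⟫ = ∑ x, (((if x = v then if u = x then 1 else 0 else 0) -
          k * (if x = u then if G.Adj v x then 1 else 0 else 0) -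
          k * (if x = v then if G.Adj u x then 1 else 0 else 0)) +
          k ^ 2 * ((if G.Adj u x then 1 else 0) * (if G.Adj v x then 1 else 0))) := by
          refine Finset.sum_congr rfl fun x _ ↦ ?_
          simp only [a, RCLike.inner_apply, conj_trivial, eq_comm (a := u)]
          split_ifs <;> ring
      _ = _ := by
          simp only [Finset.sum_add_distrib, Finset.sum_sub_distrib, ← Finset.mul_sum,
            Finset.sum_ite_eq', Finset.mem_univ, if_true, G.adj_comm v u]
          ring
  have hs : (√2 : ℝ)⁻¹ * ((√2)⁻¹ * 2) = 1 := by
    rw [← mul_assoc, ← mul_inv, mul_self_sqrt zero_le_two, inv_mul_cancel₀ two_ne_zero]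
  refine ⟨fun v ↦ (√2)⁻¹ • a v, fun v ↦ ?_, fun u v huv ↦ ?_⟩
  · rw [← sq_eq_sq₀ (norm_nonneg _) zero_le_one, ← real_inner_self_eq_norm_sq,
      real_inner_smul_left, real_inner_smul_right, ha, Finset.inter_self,
      card_neighborFinset_eq_degree, hreg.degree_eq, hk2]
    simp only [if_true, G.irrefl, if_false, one_pow, mul_zero, sub_zero]
    rw [one_add_one_eq_two, hs]
  · rw [real_inner_smul_left, real_inner_smul_right, ha,
      htf.inter_neighborFinset_eq_empty huv]
    simp only [huv.ne, huv, if_true, if_false, Finset.card_empty, Nat.cast_zero, mul_zero]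
    linear_combination (-k) * hs

end SimpleGraph

theorem stmt5 {V : Type*} [Fintype V] [DecidableEq V]
    (d : ℕ) (hd : 2 ≤ d)
    (G : SimpleGraph V) [DecidableRel G.Adj]
    (hreg : G.IsRegularOfDegree d) (htf : G.CliqueFree 3) :
    ∃ c : V → Bool,
      ((G.edgeFinset.filter (fun e => ¬ (e.map c).IsDiag)).card : ℝ)
      ≥ (1/2 + 9 / (32 * Real.sqrt d)) * G.edgeFinset.card := by
  obtain ⟨y, hy, hadj⟩ := hreg.exists_unit_vectors (by lia) htf
  have hd1 : 1 < √(d : ℝ) := by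
    rw [lt_sqrt zero_le_one, one_pow]
    exact_mod_cast hd
  have hpos : 0 < (√(d : ℝ))⁻¹ := by positivity
  have hlt : (√(d : ℝ))⁻¹ < 1 := inv_lt_one_of_one_lt₀ hd1
  obtain ⟨c, hc⟩ := G.exists_cut_of_unit_vectors y hy (abs_lt.2 ⟨by linarith, hlt⟩) hadj
  refine ⟨c, le_trans ?_ hc⟩
  refine mul_le_mul_of_nonneg_right (add_le_add le_rfl ?_) (Nat.cast_nonneg _)
  have harc : (√(d : ℝ))⁻¹ ≤ arcsin (√(d : ℝ))⁻¹ := by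
    rw [le_arcsin_iff_sin_le' ⟨by linarith [pi_pos], by linarith [pi_gt_three]⟩]
    exact sin_le hpos.le
  calc 9 / (32 * √(d : ℝ)) = 9 / 32 * (√(d : ℝ))⁻¹ := by rw [div_mul_eq_div_div, div_eq_mul_inv]
    _ ≤ 1 / π * (√(d : ℝ))⁻¹ := by
      refine mul_le_mul_of_nonneg_right ?_ hpos.le
      rw [div_le_div_iff₀ (by norm_num) pi_pos]
      linarith [pi_lt_d2]
    _ ≤ 1 / π * arcsin (√(d : ℝ))⁻¹ := by gcongr
    _ = arcsin (√(d : ℝ))⁻¹ / π := by ring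
end

section
/- Let n ≥ 1500 be an integer, let d = 2n+1, and set τ = ⌈(d + √d)/2⌉. Then 4^{-2n} · C(2n, τ-1) · Σ_{i = d-τ+1}^{τ-1} C(2n, i) > 0.2823/√(2n). -/
theorem chooseZ_natCast (m j : ℕ) : chooseZ m (j : ℤ) = m.choose j := by
  simp [chooseZ]

/-- The recurrence for the entries right of the centre of row `2 * n`. -/
theorem choose_add_succ_mul (n j : ℕ) :
    ((2 * n).choose (n + (j + 1)) : ℝ) * (n + j + 1) = (2 * n).choose (n + j) * (n - j) := by
  have h := Nat.choose_succ_right_eq (2 * n) (n + j)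
  rcases le_or_gt j n with hj | hj
  · have e : 2 * n - (n + j) = n - j := by omega
    rw [e] at h
    have h' : (((2 * n).choose (n + j + 1) * (n + j + 1) : ℕ) : ℝ)
        = ((2 * n).choose (n + j) * (n - j) : ℕ) := by exact_mod_cast h
    push_cast [Nat.cast_sub hj] at h'
    simpa [add_assoc] using h'
  · rw [Nat.choose_eq_zero_of_lt (by omega : 2 * n < n + (j + 1)),
      Nat.choose_eq_zero_of_lt (by omega : 2 * n < n + j)]
    simp

/-- A quadratic lower bound for the entries right of the centre of row `2 * n`. -/
theorem centralBinom_mul_le_choose_add (n j : ℕ) :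
    (n.centralBinom : ℝ) * (1 - 2 * (j : ℝ) ^ 2 / (2 * n + 1)) ≤ (2 * n).choose (n + j) := by
  induction j with
  | zero => simp [Nat.centralBinom]
  | succ j ih =>
    have hrec := choose_add_succ_mul n j
    have hle : ((2 * n).choose (n + j) : ℝ) ≤ n.centralBinom := by
      exact_mod_cast Nat.choose_le_centralBinom (n + j) n
    have h0 : (0 : ℝ) ≤ (2 * n).choose (n + j) := by positivity
    set a : ℝ := ((2 * n).choose (n + j) : ℝ)
    set b : ℝ := ((2 * n).choose (n + (j + 1)) : ℝ)
    set c : ℝ := (n.centralBinom : ℝ)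
    have hn : (0 : ℝ) ≤ n := by positivity
    have hj : (0 : ℝ) ≤ j := by positivity
    have hb : b = a - a * ((2 * j + 1) / (n + j + 1)) := by
      field_simp
      linarith
    have hfrac : ((2 * j + 1) / (n + j + 1) : ℝ) ≤ 2 * (2 * j + 1) / (2 * n + 1) := by
      rw [div_le_div_iff₀ (by positivity) (by positivity)]
      nlinarith [mul_nonneg hj hj]
    have hmul : a * ((2 * j + 1) / (n + j + 1)) ≤ c * (2 * (2 * j + 1) / (2 * n + 1)) := by
      gcongr
    have hsplit : c * (1 - 2 * ((j + 1 : ℕ) : ℝ) ^ 2 / (2 * n + 1))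
        = c * (1 - 2 * (j : ℝ) ^ 2 / (2 * n + 1)) - c * (2 * (2 * j + 1) / (2 * n + 1)) := by
      push_cast
      ring
    linarith

/-- A Gaussian lower bound for the entries of row `2 * n` close to the centre. -/
theorem centralBinom_mul_exp_le_choose_add (n j : ℕ) (hj : 41 * (2 * (j : ℝ) - 1) ≤ 2 * n + 1) :
    (n.centralBinom : ℝ) * Real.exp (-(2.05 * (j : ℝ) ^ 2 / (2 * n + 1)))
      ≤ (2 * n).choose (n + j) := by
  induction j with
  | zero => simp [Nat.centralBinom]
  | succ j ih =>
    push_cast at hj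
    have hrec := choose_add_succ_mul n j
    have ih := ih (by linarith)
    have hn : (0 : ℝ) ≤ n := by positivity
    have hj0 : (0 : ℝ) ≤ j := by positivity
    set a : ℝ := ((2 * n).choose (n + j) : ℝ)
    set b : ℝ := ((2 * n).choose (n + (j + 1)) : ℝ)
    have hb : b = a * ((n - j) / (n + j + 1)) := by
      field_simp
      linarith
    have hexp : Real.exp (-(2.05 * (2 * j + 1) / (2 * n + 1))) ≤ (n - j : ℝ) / (n + j + 1) := by
      have h1 := Real.add_one_le_exp (2.05 * (2 * j + 1) / (2 * n + 1) : ℝ)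
      rw [Real.exp_neg]
      refine (inv_anti₀ (by positivity) h1).trans ?_
      rw [inv_le_comm₀ (by positivity) (div_pos (by linarith) (by positivity)), inv_div,
        div_add_one (by positivity), div_le_div_iff₀ (by linarith) (by positivity)]
      nlinarith [mul_nonneg (by linarith : (0 : ℝ) ≤ 2 * j + 1)
        (by linarith : (0 : ℝ) ≤ 2 * n + 1 - 41 * (2 * j + 1))]
    have hsplit : -(2.05 * ((j + 1 : ℕ) : ℝ) ^ 2 / (2 * n + 1))
        = -(2.05 * (j : ℝ) ^ 2 / (2 * n + 1)) + -(2.05 * (2 * j + 1) / (2 * n + 1)) := by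
      push_cast
      ring
    rw [hsplit, Real.exp_add, ← mul_assoc, hb]
    gcongr

/-- A lower bound for the sum of the `2 * k` central entries of row `2 * n`. -/
theorem centralBinom_mul_le_sum_chooseZ (n k : ℕ) (hk : k ≤ n) :
    (n.centralBinom : ℝ) * (2 * k * (1 - (2 * (k : ℝ) ^ 2 + 1) / (3 * (2 * n + 1))))
      ≤ ∑ i ∈ Finset.Icc ((n : ℤ) + 1 - k) (n + k), (chooseZ (2 * n) i : ℝ) := by
  induction k with
  | zero => simp
  | succ k ih =>
    have ih := ih (by omega)
    have hIcc : Finset.Icc ((n : ℤ) + 1 - (k + 1 : ℕ)) (n + (k + 1 : ℕ))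
        = insert ((n - k : ℕ) : ℤ) (insert ((n + (k + 1) : ℕ) : ℤ)
          (Finset.Icc ((n : ℤ) + 1 - k) (n + k))) := by
      ext i
      simp only [Finset.mem_Icc, Finset.mem_insert]
      omega
    rw [hIcc, Finset.sum_insert (by simp only [Finset.mem_Icc, Finset.mem_insert]; omega),
      Finset.sum_insert (by simp only [Finset.mem_Icc]; omega), chooseZ_natCast, chooseZ_natCast,
      Nat.choose_symm_of_eq_add (by omega : 2 * n = (n - k) + (n + k))]
    have h1 := centralBinom_mul_le_choose_add n k
    have h2 := centralBinom_mul_le_choose_add n (k + 1)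
    have hsplit : (n.centralBinom : ℝ) * (2 * (k + 1 : ℕ)
          * (1 - (2 * ((k + 1 : ℕ) : ℝ) ^ 2 + 1) / (3 * (2 * n + 1))))
        = n.centralBinom * (1 - 2 * (k : ℝ) ^ 2 / (2 * n + 1))
          + (n.centralBinom * (1 - 2 * ((k + 1 : ℕ) : ℝ) ^ 2 / (2 * n + 1))
          + n.centralBinom * (2 * k * (1 - (2 * (k : ℝ) ^ 2 + 1) / (3 * (2 * n + 1))))) := by
      push_cast
      field_simp
      ring
    linarith

theorem le_mul_centralBinom_sq (n : ℕ) (hn : 20 ≤ n) :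
    (0.314 : ℝ) * 4 ^ (2 * n) ≤ n * (n.centralBinom : ℝ) ^ 2 := by
  induction n, hn using Nat.le_induction with
  | base =>
    have h : Nat.centralBinom 20 = 137846528820 := by
      norm_num [Nat.centralBinom_eq_two_mul_choose, Nat.choose]
    rw [h]
    norm_num
  | succ n hn ih =>
    have h : ((n : ℝ) + 1) * (n + 1).centralBinom = 2 * (2 * n + 1) * n.centralBinom := by
      exact_mod_cast Nat.succ_mul_centralBinom_succ n
    have hc : ((n + 1).centralBinom : ℝ) = 2 * (2 * n + 1) * n.centralBinom / (n + 1) := by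
      field_simp
      linarith
    have hstep : 16 * (n * (n.centralBinom : ℝ) ^ 2)
        ≤ (n + 1 : ℕ) * ((n + 1).centralBinom : ℝ) ^ 2 := by
      rw [hc]
      push_cast
      rw [div_pow, mul_div_assoc', le_div_iff₀ (by positivity)]
      nlinarith [mul_nonneg (sq_nonneg (n.centralBinom : ℝ)) (by positivity : (0 : ℝ) ≤ n + 1)]
    calc (0.314 : ℝ) * 4 ^ (2 * (n + 1)) = 16 * (0.314 * 4 ^ (2 * n)) := by ring
      _ ≤ _ := by linarith

theorem stmt14 (n : ℕ) (hn : 1500 ≤ n) (d : ℕ) (hd : d = 2 * n + 1) (τ : ℤ)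
    (hτ : τ = ⌈((d : ℝ) + Real.sqrt d) / 2⌉) :
    (chooseZ (2 * n) (τ - 1) : ℝ) / 4 ^ (2 * n)
      * ∑ i ∈ Finset.Icc ((d : ℤ) - τ + 1) (τ - 1), (chooseZ (2 * n) i : ℝ)
    > 0.2823 / Real.sqrt (2 * (n : ℝ)) := by
  have hnR : (1500 : ℝ) ≤ n := by exact_mod_cast hn
  have hdR : (d : ℝ) = 2 * n + 1 := by exact_mod_cast hd
  have hs2 : Real.sqrt d ^ 2 = 2 * n + 1 := by rw [Real.sq_sqrt (by positivity), hdR]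
  have hs54 : 54.7 ≤ Real.sqrt d := Real.le_sqrt_of_sq_le (by rw [hdR]; norm_num; linarith)
  have hst : Real.sqrt (2 * n) ≤ Real.sqrt d := Real.sqrt_le_sqrt (by linarith)
  have ht2 : Real.sqrt (2 * n) ^ 2 = 2 * n := Real.sq_sqrt (by positivity)
  have ht0 : 0 < Real.sqrt (2 * n) := Real.sqrt_pos.2 (by linarith)
  have hτl := Int.le_ceil (((d : ℝ) + Real.sqrt d) / 2)
  have hτu := Int.ceil_lt_add_one (((d : ℝ) + Real.sqrt d) / 2)
  rw [← hτ] at hτl hτu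
  set s := Real.sqrt d
  set t := Real.sqrt (2 * (n : ℝ))
  obtain ⟨k, hk⟩ : ∃ k : ℕ, τ = n + k + 1 := by
    have h : (n : ℝ) + 1 < τ := by linarith
    have h' : (n : ℤ) + 1 < τ := by exact_mod_cast h
    exact ⟨(τ - n - 1).toNat, by omega⟩
  have hτR : (τ : ℝ) = n + k + 1 := by exact_mod_cast congrArg (Int.cast : ℤ → ℝ) hk
  have hkl : s - 1 ≤ 2 * k := by linarith
  have hku : 2 * k ≤ s + 1 := by linarith
  have hkn : k ≤ n := by
    have : (k : ℝ) ≤ n := by nlinarith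
    exact_mod_cast this
  have e1 : (d : ℤ) - τ + 1 = n + 1 - k := by omega
  have e2 : τ - 1 = ((n + k : ℕ) : ℤ) := by push_cast; omega
  rw [e1, e2, chooseZ_natCast]
  push_cast
  have hsum := centralBinom_mul_le_sum_chooseZ n k hkn
  have hgauss := centralBinom_mul_exp_le_choose_add n k (by nlinarith)
  have hc := le_mul_centralBinom_sq n (by omega)
  have hexp : (0.57 : ℝ) ≤ Real.exp (-(2.05 * (k : ℝ) ^ 2 / (2 * n + 1))) := by
    have hx : 2.05 * (k : ℝ) ^ 2 / (2 * n + 1) ≤ 0.532 := by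
      rw [div_le_iff₀ (by positivity), ← hs2]
      nlinarith
    calc (0.57 : ℝ) ≤ (1 - 0.532 / (8 : ℕ)) ^ 8 := by norm_num
      _ ≤ Real.exp (-0.532) := Real.one_sub_div_pow_le_exp_neg (by norm_num)
      _ ≤ _ := Real.exp_le_exp.2 (by linarith)
  have hwidth : 0.82 * s ≤ 2 * k * (1 - (2 * (k : ℝ) ^ 2 + 1) / (3 * (2 * n + 1))) := by
    have hk1 : 0.4908 * s ≤ k := by linarith
    have hk2 : k ≤ 0.5092 * s := by linarith
    have h : (2 * (k : ℝ) ^ 2 + 1) / (3 * (2 * n + 1)) ≤ (2 * (k / s) ^ 2 + 0.001) / 3 := by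
      rw [← hs2, div_le_div_iff₀ (by positivity) (by positivity), div_pow]
      field_simp
      nlinarith
    have hκ1 : 0.4908 ≤ k / s := (le_div_iff₀ (by linarith)).2 hk1
    have hκ2 : k / s ≤ 0.5092 := (div_le_iff₀ (by linarith)).2 hk2
    have hks : (k : ℝ) = k / s * s := by field_simp
    set κ := (k : ℝ) / s
    have h' : 0.82 ≤ 2 * κ * (1 - (2 * κ ^ 2 + 0.001) / 3) := by
      nlinarith [mul_nonneg (sub_nonneg.2 hκ1) (sub_nonneg.2 hκ2)]
    calc 0.82 * s ≤ 2 * κ * (1 - (2 * κ ^ 2 + 0.001) / 3) * s := by gcongr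
      _ = 2 * k * (1 - (2 * κ ^ 2 + 0.001) / 3) := by rw [hks]; ring
      _ ≤ _ := by gcongr
  set S := ∑ i ∈ Finset.Icc ((n : ℤ) + 1 - k) (n + k), (chooseZ (2 * n) i : ℝ)
  have hS : (n.centralBinom : ℝ) * (0.82 * t) ≤ S :=
    (mul_le_mul_of_nonneg_left (by linarith) (by positivity)).trans hsum
  have hA : (n.centralBinom : ℝ) * 0.57 ≤ (2 * n).choose (n + k) :=
    (mul_le_mul_of_nonneg_left hexp (by positivity)).trans hgauss
  rw [gt_iff_lt, div_mul_eq_mul_div, div_lt_div_iff₀ ht0 (by positivity)]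
  calc (0.2823 : ℝ) * 4 ^ (2 * n) < 0.57 * 0.82 * 2 * (0.314 * 4 ^ (2 * n)) := by
        have : (0 : ℝ) < 4 ^ (2 * n) := by positivity
        linarith
    _ ≤ 0.57 * 0.82 * 2 * (n * (n.centralBinom : ℝ) ^ 2) := by gcongr
    _ = (n.centralBinom * 0.57) * (n.centralBinom * (0.82 * t)) * t := by
        linear_combination (-0.57 * 0.82 * (n.centralBinom : ℝ) ^ 2) * ht2
    _ ≤ (2 * n).choose (n + k) * S * t :=
        mul_le_mul_of_nonneg_right (mul_le_mul hA hS (by positivity) (Nat.cast_nonneg _)) ht0.le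
end

section
/- Let n > 1500 be an integer, let d = 2n, and set τ = ⌈(d + √d)/2⌉. Then 4^{-(2n-1)} · C(2n-1, τ-1) · Σ_{i = d-τ+1}^{τ-1} C(2n-1, i) > 0.2822/√(2n). -/
theorem choose_mul_exp_le_choose_add (n : ℕ) (D : ℝ) (hD : 0 < D) (j : ℕ) (hj : (j : ℝ) + D ≤ n) :
    ((2 * n - 1).choose n : ℝ) * Real.exp (-((j : ℝ) * (j + 1)) / D)
      ≤ ((2 * n - 1).choose (n + j) : ℝ) := by
  induction j with
  | zero => simp
  | succ j ih =>
    push_cast at hj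
    have ih' := ih (by linarith)
    have hlt : j + 1 < n := by
      have : ((j + 1 : ℕ) : ℝ) < n := by push_cast; linarith
      exact_mod_cast this
    have hrec := Nat.choose_succ_right_eq (2 * n - 1) (n + j)
    have hsub : 2 * n - 1 - (n + j) = n - (j + 1) := by omega
    rw [hsub] at hrec
    have hrec' : ((2 * n - 1).choose (n + (j + 1)) : ℝ) * (n + j + 1)
        = ((2 * n - 1).choose (n + j) : ℝ) * (n - (j + 1)) := by
      have h := congrArg (Nat.cast : ℕ → ℝ) hrec
      rw [Nat.cast_mul, Nat.cast_mul, Nat.cast_sub hlt.le] at h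
      push_cast at h
      exact h
    have hpos : (0 : ℝ) < n - (j + 1) := by linarith
    have hexp : (n + j + 1 : ℝ) * Real.exp (-(2 * (j + 1)) / D) ≤ n - (j + 1) := by
      have h1 : 2 * ((j : ℝ) + 1) / (n - (j + 1)) + 1 ≤ Real.exp (2 * (j + 1) / D) :=
        (Real.add_one_le_exp _).trans (Real.exp_le_exp.mpr (by gcongr; linarith))
      have h2 : (n + j + 1 : ℝ) ≤ (n - (j + 1)) * Real.exp (2 * (j + 1) / D) := by
        calc (n + j + 1 : ℝ) = (n - (j + 1)) * (2 * ((j : ℝ) + 1) / (n - (j + 1)) + 1) := by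
              field_simp; ring
          _ ≤ _ := by gcongr
      rw [neg_div, Real.exp_neg, ← div_eq_mul_inv, div_le_iff₀ (Real.exp_pos _)]
      exact h2
    have hsplit : Real.exp (-(((j + 1 : ℕ) : ℝ) * ((j + 1 : ℕ) + 1)) / D)
        = Real.exp (-((j : ℝ) * (j + 1)) / D) * Real.exp (-(2 * (j + 1)) / D) := by
      rw [← Real.exp_add]
      congr 1
      push_cast
      ring
    have hden : (0 : ℝ) < n + j + 1 := by positivity
    rw [hsplit]
    refine le_of_mul_le_mul_right ?_ hden
    rw [hrec']
    calc _ = ((2 * n - 1).choose n * Real.exp (-((j : ℝ) * (j + 1)) / D))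
          * ((n + j + 1) * Real.exp (-(2 * (j + 1)) / D)) := by ring
      _ ≤ _ := by gcongr

theorem two_mul_four_pow_le_choose_sq (n : ℕ) (hn : 1 ≤ n) :
    2 * (4 : ℝ) ^ (2 * n - 1) ≤ ((2 * n - 1).choose n : ℝ) ^ 2 * ((2 * n + 1) * Real.pi) := by
  have hW := Real.Wallis.W_le n
  rw [Real.Wallis.W_eq_factorial_ratio, div_le_iff₀ (by positivity)] at hW
  have hc : ((2 * n).factorial : ℝ) = 2 * (2 * n - 1).choose n * (n.factorial : ℝ) ^ 2 := by
    obtain ⟨k, rfl⟩ : ∃ k, n = k + 1 := ⟨n - 1, by omega⟩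
    have h1 : (2 * (k + 1)).choose (k + 1) = 2 * (2 * (k + 1) - 1).choose (k + 1) := by
      have : 2 * (k + 1) - 1 = 2 * k + 1 := by omega
      rw [this, show 2 * (k + 1) = 2 * k + 1 + 1 by ring, Nat.choose_succ_succ,
        Nat.choose_symm_half]
      ring
    have h2 := Nat.choose_mul_factorial_mul_factorial (show k + 1 ≤ 2 * (k + 1) by omega)
    rw [show 2 * (k + 1) - (k + 1) = k + 1 by omega, h1] at h2
    rw [← h2]
    push_cast
    ring
  have hpow : (2 : ℝ) ^ (4 * n) = 4 * 4 ^ (2 * n - 1) := by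
    rw [← pow_succ', show 2 * n - 1 + 1 = 2 * n by omega, show 4 * n = 2 * (2 * n) by ring, pow_mul]
    norm_num
  rw [hc, hpow] at hW
  have hf : (0 : ℝ) < 2 * (n.factorial : ℝ) ^ 4 := by positivity
  refine le_of_mul_le_mul_right ?_ hf
  linarith

theorem sum_one_sub_range (m : ℕ) (D : ℝ) :
    ∑ j ∈ Finset.range m, (1 - (j : ℝ) * (j + 1) / D) = m - ((m : ℝ) ^ 3 - m) / (3 * D) := by
  by_cases hD : D = 0
  · simp [hD]
  induction m with
  | zero => simp
  | succ m ih =>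
    rw [Finset.sum_range_succ, ih]
    push_cast
    field_simp
    ring

theorem chooseZ_natCast_s15 (n k : ℕ) : chooseZ n (k : ℤ) = n.choose k := by
  simp [chooseZ]

theorem two_mul_sum_choose_le_sum_chooseZ (n m : ℕ) (hm : m < n) :
    2 * ∑ j ∈ Finset.range m, ((2 * n - 1).choose (n + j) : ℝ)
      ≤ ∑ i ∈ Finset.Icc ((n : ℤ) - m) (n + m), (chooseZ (2 * n - 1) i : ℝ) := by
  have hupper : ∑ j ∈ Finset.range m, ((2 * n - 1).choose (n + j) : ℝ)
      = ∑ i ∈ (Finset.range m).image (fun j : ℕ => (n : ℤ) + j),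
          (chooseZ (2 * n - 1) i : ℝ) := by
    rw [Finset.sum_image (by intro a _ b _ h; simpa using h)]
    refine Finset.sum_congr rfl fun j _ => ?_
    rw [← chooseZ_natCast_s15]
    push_cast
    rfl
  have hlower : ∑ j ∈ Finset.range m, ((2 * n - 1).choose (n + j) : ℝ)
      = ∑ i ∈ (Finset.range m).image (fun j : ℕ => (n : ℤ) - 1 - j),
          (chooseZ (2 * n - 1) i : ℝ) := by
    rw [Finset.sum_image (by intro a _ b _ h; simpa using h)]
    refine Finset.sum_congr rfl fun j hj => ?_
    have hj' := Finset.mem_range.mp hj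
    rw [show (n : ℤ) - 1 - j = ((n - 1 - j : ℕ) : ℤ) by omega, chooseZ_natCast_s15,
      Nat.choose_symm_of_eq_add (show 2 * n - 1 = (n + j) + (n - 1 - j) by omega)]
  have hdisj : Disjoint ((Finset.range m).image (fun j : ℕ => (n : ℤ) + j))
      ((Finset.range m).image (fun j : ℕ => (n : ℤ) - 1 - j)) := by
    rw [Finset.disjoint_left]
    intro x hx hy
    simp only [Finset.mem_image, Finset.mem_range] at hx hy
    obtain ⟨i, hi, rfl⟩ := hx
    obtain ⟨j, hj, h⟩ := hy
    omega
  rw [two_mul]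
  nth_rewrite 1 [hupper]
  rw [hlower, ← Finset.sum_union hdisj]
  refine Finset.sum_le_sum_of_subset_of_nonneg ?_ fun _ _ _ => Nat.cast_nonneg _
  intro x hx
  simp only [Finset.mem_union, Finset.mem_image, Finset.mem_range, Finset.mem_Icc] at hx ⊢
  rcases hx with ⟨j, hj, rfl⟩ | ⟨j, hj, rfl⟩ <;> constructor <;> omega

theorem stmt15 (n : ℕ) (hn : 1500 < n) (d : ℕ) (hd : d = 2 * n) (τ : ℤ)
    (hτ : τ = ⌈((d : ℝ) + Real.sqrt d) / 2⌉) :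
    (chooseZ (2 * n - 1) (τ - 1) : ℝ) / 4 ^ (2 * n - 1)
      * ∑ i ∈ Finset.Icc ((d : ℤ) - τ + 1) (τ - 1), (chooseZ (2 * n - 1) i : ℝ)
    > 0.2822 / Real.sqrt (2 * (n : ℝ)) := by
  obtain ⟨s, hs⟩ : ∃ s : ℝ, s = Real.sqrt (2 * (n : ℝ)) / 2 := ⟨_, rfl⟩
  have hsqrt : Real.sqrt (2 * (n : ℝ)) = 2 * s := by rw [hs]; ring
  have hs0 : 0 ≤ s := by rw [hs]; positivity
  have hns : (n : ℝ) = 2 * s ^ 2 := by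
    have := Real.sq_sqrt (show (0 : ℝ) ≤ 2 * n by positivity)
    rw [hsqrt] at this
    linarith
  have hn' : (1500 : ℝ) < n := by exact_mod_cast hn
  have hs27 : 27.38 < s := by nlinarith
  obtain ⟨m, hm⟩ : ∃ m : ℕ, τ = n + m + 1 := by
    have h : (n : ℤ) + 1 ≤ τ := by
      rw [Int.add_one_le_iff, hτ, Int.lt_ceil, hd]
      push_cast
      rw [hsqrt]
      linarith
    exact ⟨(τ - n - 1).toNat, by omega⟩
  have hceil : ((n : ℝ) + m < n + s) ∧ (n : ℝ) + s ≤ n + m + 1 := by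
    have h := Int.ceil_eq_iff.mp hτ.symm
    rw [hd, hm] at h
    push_cast at h
    rw [hsqrt] at h
    constructor <;> linarith [h.1, h.2]
  have hms : (m : ℝ) < s := by linarith [hceil.1]
  have hsm : s - 1 ≤ m := by linarith [hceil.2]
  have hmn : m < n := by
    have : (m : ℝ) < n := by nlinarith
    exact_mod_cast this
  obtain ⟨D, hDdef⟩ : ∃ D : ℝ, D = n - s := ⟨_, rfl⟩
  have hD : 0 < D := by nlinarith
  have hDs : D = s * (2 * s - 1) := by rw [hDdef, hns]; ring
  set A : ℝ := ((2 * n - 1).choose n : ℝ) with hA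
  have hA0 : 0 ≤ A := Nat.cast_nonneg _
  have htail : A * 0.58 ≤ (chooseZ (2 * n - 1) (τ - 1) : ℝ) := by
    have h1 : (chooseZ (2 * n - 1) (τ - 1) : ℝ) = ((2 * n - 1).choose (n + m) : ℝ) := by
      rw [← chooseZ_natCast_s15, hm]
      congr 2
      push_cast
      ring
    rw [h1]
    refine le_trans ?_ (choose_mul_exp_le_choose_add n D hD m (by linarith))
    gcongr
    have h2 : -(0.53 : ℝ) ≤ -((m : ℝ) * (m + 1)) / D := by
      rw [le_div_iff₀ hD, hDs]
      have : (m : ℝ) * (m + 1) ≤ s * (s + 1) := by gcongr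
      nlinarith
    refine le_trans ?_ (Real.exp_le_exp.mpr h2)
    rw [Real.exp_neg, le_inv_comm₀ (by norm_num) (Real.exp_pos _)]
    have h3 := Real.exp_bound' (x := 0.53) (by norm_num) (by norm_num) (n := 5) (by norm_num)
    refine h3.trans ?_
    norm_num [Finset.sum_range_succ, Nat.factorial]
  have hsum : A * (0.82 * (s - 1)) ≤ ∑ j ∈ Finset.range m, ((2 * n - 1).choose (n + j) : ℝ) := by
    calc A * (0.82 * (s - 1)) ≤ A * (m - ((m : ℝ) ^ 3 - m) / (3 * D)) := by
          gcongr
          have h1 : ((m : ℝ) ^ 3 - m) / (3 * D) ≤ 0.18 * m := by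
            rw [div_le_iff₀ (by positivity), hDs]
            have h2 : (m : ℝ) ^ 2 - 1 ≤ 0.18 * (3 * (s * (2 * s - 1))) := by nlinarith
            nlinarith [mul_le_mul_of_nonneg_left h2 (Nat.cast_nonneg (α := ℝ) m)]
          linarith
      _ = ∑ j ∈ Finset.range m, A * (1 - (j : ℝ) * (j + 1) / D) := by
          rw [← Finset.mul_sum, sum_one_sub_range]
      _ ≤ _ := by
          refine Finset.sum_le_sum fun j hj => ?_
          have hjm : (j : ℝ) ≤ m := by exact_mod_cast (Finset.mem_range.mp hj).le
          refine le_trans ?_ (choose_mul_exp_le_choose_add n D hD j (by linarith))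
          gcongr
          have := Real.add_one_le_exp (-((j : ℝ) * (j + 1)) / D)
          rw [neg_div] at this ⊢
          linarith
  have hSum : 2 * (A * (0.82 * (s - 1)))
      ≤ ∑ i ∈ Finset.Icc ((d : ℤ) - τ + 1) (τ - 1), (chooseZ (2 * n - 1) i : ℝ) := by
    have h := two_mul_sum_choose_le_sum_chooseZ n m hmn
    rw [show (d : ℤ) - τ + 1 = n - m by rw [hd, hm]; push_cast; ring,
      show τ - 1 = n + m by rw [hm]; ring]
    linarith
  have hcentral : 2 / ((2 * n + 1) * Real.pi) ≤ A ^ 2 / 4 ^ (2 * n - 1) := by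
    rw [div_le_div_iff₀ (by positivity) (by positivity)]
    exact two_mul_four_pow_le_choose_sq n (by omega)
  rw [hsqrt]
  calc 0.2822 / (2 * s)
      < 2 / ((2 * n + 1) * Real.pi) * (0.58 * (2 * (0.82 * (s - 1)))) := by
        rw [div_mul_eq_mul_div, div_lt_div_iff₀ (by positivity) (by positivity), hns]
        have hpi := Real.pi_lt_d4
        have h1 : (2 * (2 * s ^ 2) + 1) * Real.pi ≤ (2 * (2 * s ^ 2) + 1) * 3.1416 := by gcongr
        nlinarith
    _ ≤ A ^ 2 / 4 ^ (2 * n - 1) * (0.58 * (2 * (0.82 * (s - 1)))) := by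
        gcongr
        nlinarith
    _ = A * 0.58 / 4 ^ (2 * n - 1) * (2 * (A * (0.82 * (s - 1)))) := by ring
    _ ≤ _ := by
        have : 0 ≤ s - 1 := by linarith
        gcongr
end

section
/- Let d ≥ 2 be an integer, set τ = ⌈(d + √d)/2⌉, let 0 ≤ ε ≤ 1 be a real number, and let G be a d-regular simple graph on a finite vertex set V with edge set E such that the number of edges {u,v} ∈ E whose endpoints have a common neighbour is at most ε · |E|. Then the average, over all 2^|V| functions c : V → {a,b}, of the number of edges {u,v} ∈ E with A_τ(c)(u) ≠ A_τ(c)(v), is at least (1 - ε) · (1/2 + 9/(32·√d)) · |E|. -/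
open Finset

theorem two_mul_sum_agree {V : Type*} [Fintype V] [DecidableEq V] (w : V)
    (t : (V → Bool) → Bool) (H : (V → Bool) → Prop → ℝ)
    (ht : ∀ c b, t (Function.update c w b) = t c)
    (hH : ∀ c b, H (Function.update c w b) = H c) :
    2 * ∑ c, H c (c w = t c) = ∑ c, (H c True + H c False) := by
  have hflip : ∑ c, H c (c w = t c) = ∑ c, H c (¬ c w = t c) := by
    have hinv : Function.Involutive fun c : V → Bool => Function.update c w (!c w) := by
      intro c; simp
    refine Fintype.sum_equiv hinv.toPerm _ _ fun c => ?_
    simp only [Function.Involutive.coe_toPerm, hH, ht, Function.update_self]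
    congr 1
    cases c w <;> cases t c <;> simp
  rw [two_mul]
  nth_rw 2 [hflip]
  rw [← sum_add_distrib]
  refine sum_congr rfl fun c _ => ?_
  by_cases h : c w = t c <;> simp [h, add_comm]

theorem two_pow_card_mul_sum_agree {V : Type*} [Fintype V] [DecidableEq V] (A : Finset V)
    (t : (V → Bool) → Bool) (F : (V → Bool) → ℕ → ℝ)
    (ht : ∀ c, ∀ w ∈ A, ∀ b, t (Function.update c w b) = t c)
    (hF : ∀ c, ∀ w ∈ A, ∀ b, F (Function.update c w b) = F c) :
    2 ^ #A * ∑ c, F c #{y ∈ A | c y = t c} = ∑ c, ∑ S ∈ A.powerset, F c #S := by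
  classical
  induction A using Finset.induction_on generalizing F with
  | empty => simp
  | insert w A hw ih =>
    have h₁ := ih (fun c k => F c (k + if c w = t c then 1 else 0))
      (fun c y hy => ht c y (mem_insert_of_mem hy))
      (fun c y hy b => by
        have : w ≠ y := by rintro rfl; exact hw hy
        simp [hF c y (mem_insert_of_mem hy), ht c y (mem_insert_of_mem hy), this])
    have h₂ := two_mul_sum_agree w t
      (fun c p => ∑ S ∈ A.powerset, F c (#S + open Classical in if p then 1 else 0))
      (fun c b => ht c w (mem_insert_self _ _) b)
      (fun c b => by simp [hF c w (mem_insert_self _ _)])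
    have h₃ : ∀ c : V → Bool, #{y ∈ insert w A | c y = t c} =
        #{y ∈ A | c y = t c} + if c w = t c then 1 else 0 := by
      intro c
      rw [filter_insert]
      split_ifs <;> simp [hw]
    simp only [h₃, card_insert_of_notMem hw, sum_powerset_insert hw, pow_succ]
    rw [mul_comm _ (2 : ℝ), mul_assoc, h₁]
    convert h₂ using 2 with c _ c _
    · congr! 4
      split_ifs <;> rfl
    · simp only [if_true, if_false, add_zero]
      rw [add_comm]
      congr 1
      refine sum_congr rfl fun S hS => ?_
      rw [card_insert_of_notMem fun h => hw (mem_powerset.1 hS h)]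

theorem sum_sum_ite_iff {α β : Type*} (s : Finset α) (t : Finset β) (p : α → Prop) (q : β → Prop)
    [DecidablePred p] [DecidablePred q] :
    ∑ x ∈ s, ∑ y ∈ t, (if (p x ↔ q y) then (1 : ℝ) else 0) =
      #{x ∈ s | p x} * #{y ∈ t | q y} + (#s - #{x ∈ s | p x}) * (#t - #{y ∈ t | q y}) := by
  have h : ∀ x y, (if (p x ↔ q y) then (1 : ℝ) else 0) =
      (if p x then 1 else 0) * (if q y then 1 else 0) +
        (1 - if p x then 1 else 0) * (1 - if q y then 1 else 0) := by
    intro x y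
    by_cases hp : p x <;> by_cases hq : q y <;> simp [hp, hq]
  simp only [h, sum_add_distrib, ← mul_sum, ← sum_mul, sum_sub_distrib]
  simp

theorem card_filter_powerset_card_lt {V : Type*} (A : Finset V) {τ : ℕ} (hτ : τ ≤ #A + 1) :
    #{S ∈ A.powerset | #S < τ} = ∑ k ∈ range τ, (#A).choose k := by
  rw [card_filter, sum_powerset_apply_card (fun k => if k < τ then 1 else 0)]
  simp only [smul_eq_mul, mul_ite, mul_one, mul_zero]
  rw [← sum_filter]
  congr 1
  ext k
  simp
  omega

theorem sum_choose_range_add_sum_choose_range {n k : ℕ} (hk : k ≤ n + 1) :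
    ∑ r ∈ range k, n.choose r + ∑ r ∈ range (n + 1 - k), n.choose r = 2 ^ n := by
  rw [← Nat.sum_range_choose, ← sum_range_add_sum_Ico _ hk, add_right_inj]
  refine sum_nbij' (fun r => n - r) (fun r => n - r) ?_ ?_ ?_ ?_ ?_
  all_goals intro r hr; simp only [mem_range, mem_Ico] at hr ⊢
  · omega
  · omega
  · omega
  · omega
  · exact (Nat.choose_symm (by omega)).symm

theorem sum_choose_range_succ_add {d τ : ℕ} (h0 : 1 ≤ τ) (hτ : τ ≤ d) (h1 : d < 2 * τ) :
    (∑ k ∈ range (τ - 1), ((d - 1).choose k : ℝ)) + ∑ k ∈ range τ, ((d - 1).choose k : ℝ) =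
      2 ^ (d - 1) + ∑ k ∈ Ico (d - τ) (τ - 1), ((d - 1).choose k : ℝ) := by
  have h := sum_choose_range_add_sum_choose_range (n := d - 1) (k := τ) (by omega)
  rw [show d - 1 + 1 - τ = d - τ by omega] at h
  have h' : (∑ k ∈ range τ, ((d - 1).choose k : ℝ)) +
      ∑ k ∈ range (d - τ), ((d - 1).choose k : ℝ) = 2 ^ (d - 1) := by exact_mod_cast h
  rw [← sum_range_add_sum_Ico _ (show d - τ ≤ τ - 1 by omega)]
  linarith

/-- The number of cuts after which the threshold algorithm separates the two ends of an edge
that lies in no triangle. -/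
theorem card_separated_eq {V : Type*} [Fintype V] [DecidableEq V] {d τ : ℕ} (hd : 1 ≤ d)
    (h0 : 1 ≤ τ) (hτ : τ ≤ d) (h1 : d < 2 * τ) {G : SimpleGraph V} [DecidableRel G.Adj]
    (hreg : G.IsRegularOfDegree d) {u v : V} (huv : G.Adj u v)
    (hcn : ¬ ∃ w, G.Adj u w ∧ G.Adj v w) {f : (V → Bool) → V → Bool}
    (hf : ∀ c x, f c x =
      if ((G.neighborFinset x).filter (fun y => c y = c x)).card < τ then c x else !(c x)) :
    (∑ c : V → Bool, if f c u ≠ f c v then (1 : ℝ) else 0) = 2 ^ Fintype.card V *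
      (1 / 2 + (d - 1).choose (τ - 1) *
        (∑ k ∈ Ico (d - τ) (τ - 1), ((d - 1).choose k : ℝ)) / (2 ^ (d - 1)) ^ 2) := by
  set A := (G.neighborFinset u).erase v with hA
  set B := (G.neighborFinset v).erase u with hB
  have hAc : #A = d - 1 := by
    rw [hA, card_erase_of_mem (by simpa using huv), G.card_neighborFinset_eq_degree, hreg u]
  have hBc : #B = d - 1 := by
    rw [hB, card_erase_of_mem (by simpa using huv.symm), G.card_neighborFinset_eq_degree, hreg v]
  have hNu : G.neighborFinset u = insert v A := (insert_erase (by simpa using huv)).symm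
  have hNv : G.neighborFinset v = insert u B := (insert_erase (by simpa using huv.symm)).symm
  have huA : u ∉ A := by simp [hA]
  have hvA : v ∉ A := by simp [hA]
  have huB : u ∉ B := by simp [hB]
  have hvB : v ∉ B := by simp [hB]
  have hAB : ∀ w ∈ A, w ∉ B := by
    intro w hwA hwB
    simp only [hA, hB, mem_erase, SimpleGraph.mem_neighborFinset] at hwA hwB
    exact hcn ⟨w, hwA.2, hwB.2⟩
  have hne : u ≠ v := huv.ne
  let K : Prop → ℕ → ℕ → ℝ := fun p j k => open Classical in
    if p then 1 - (if (j < τ - 1 ↔ k < τ - 1) then 1 else 0)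
      else (if (j < τ ↔ k < τ) then 1 else 0)
  have hK : ∀ c : V → Bool, (if f c u ≠ f c v then (1 : ℝ) else 0) =
      K (c u = c v) #{y ∈ A | c y = c u} #{y ∈ B | c y = c v} := by
    intro c
    rw [hf, hf, hNu, hNv, filter_insert, filter_insert]
    by_cases h : c u = c v
    · have h₁ : v ∉ ({y ∈ A | c y = c v} : Finset V) := by simp [hvA]
      have h₂ : u ∉ ({y ∈ B | c y = c v} : Finset V) := by simp [huB]
      simp only [h, if_true, card_insert_of_notMem h₁, card_insert_of_notMem h₂, K]
      generalize #{y ∈ A | c y = c v} = j, #{y ∈ B | c y = c v} = k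
      simp only [← Nat.lt_sub_iff_add_lt]
      by_cases hj : j < τ - 1 <;> by_cases hk : k < τ - 1 <;> simp [hj, hk]
    · have h' : ¬ c v = c u := fun h' => h h'.symm
      simp only [h, h', if_false, K]
      generalize #{y ∈ A | c y = c u} = j, #{y ∈ B | c y = c v} = k
      by_cases hj : j < τ <;> by_cases hk : k < τ <;> simp [hj, hk] <;>
        cases hu : c u <;> cases hv : c v <;> simp_all
  set N : ℝ := 2 ^ (d - 1) with hN
  set L : ℝ := ∑ k ∈ range (τ - 1), ((d - 1).choose k : ℝ) with hL
  set L' : ℝ := ∑ k ∈ range τ, ((d - 1).choose k : ℝ) with hL'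
  have hLA : ∀ (S : Finset V), #S = d - 1 → (#{T ∈ S.powerset | #T < τ - 1} : ℝ) = L := by
    intro S hS
    rw [card_filter_powerset_card_lt S (by omega), hS]; push_cast; rfl
  have hLA' : ∀ (S : Finset V), #S = d - 1 → (#{T ∈ S.powerset | #T < τ} : ℝ) = L' := by
    intro S hS
    rw [card_filter_powerset_card_lt S (by omega), hS]; push_cast; rfl
  have hT : ∑ S ∈ A.powerset, ∑ T ∈ B.powerset, K True #S #T =
      N ^ 2 - (L * L + (N - L) * (N - L)) := by
    simp only [K, if_true, sum_sub_distrib]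
    have := sum_sum_ite_iff A.powerset B.powerset (fun S => #S < τ - 1) (fun S => #S < τ - 1)
    simp only [hLA _ hAc, hLA _ hBc, card_powerset, hAc, hBc, Nat.cast_pow, Nat.cast_ofNat] at this
    rw [← hN] at this
    convert congrArg (N ^ 2 - ·) this using 2
    simp [hAc, hBc, hN, sq]
  have hF : ∑ S ∈ A.powerset, ∑ T ∈ B.powerset, K False #S #T =
      L' * L' + (N - L') * (N - L') := by
    simp only [K, if_false]
    have := sum_sum_ite_iff A.powerset B.powerset (fun S => #S < τ) (fun S => #S < τ)
    simp only [hLA' _ hAc, hLA' _ hBc, card_powerset, hAc, hBc, Nat.cast_pow,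
      Nat.cast_ofNat] at this
    rw [← hN] at this
    convert this
  have e₁ := two_pow_card_mul_sum_agree A (fun c => c u)
    (fun c j => K (c u = c v) j #{y ∈ B | c y = c v})
    (fun c w hw b => by
      have : u ≠ w := by rintro rfl; exact huA hw
      simp [this])
    (fun c w hw b => by
      have h₁ : u ≠ w := by rintro rfl; exact huA hw
      have h₂ : v ≠ w := by rintro rfl; exact hvA hw
      have h₃ : ({y ∈ B | Function.update c w b y = c v} : Finset V) = {y ∈ B | c y = c v} := by
        refine filter_congr fun y hy => ?_
        have : y ≠ w := by rintro rfl; exact hAB _ hw hy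
        simp [this]
      simp [h₁, h₂, h₃])
  have e₂ := two_pow_card_mul_sum_agree B (fun c => c v)
    (fun c k => ∑ S ∈ A.powerset, K (c u = c v) #S k)
    (fun c w hw b => by
      have : v ≠ w := by rintro rfl; exact hvB hw
      simp [this])
    (fun c w hw b => by
      have h₁ : u ≠ w := by rintro rfl; exact huB hw
      have h₂ : v ≠ w := by rintro rfl; exact hvB hw
      simp [h₁, h₂])
  have e₃ := two_mul_sum_agree u (fun c => c v)
    (fun _ p => ∑ T ∈ B.powerset, ∑ S ∈ A.powerset, K p #S #T)
    (fun c b => by simp [hne.symm]) (fun c b => rfl)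
  rw [sum_congr rfl fun c _ => hK c]
  simp only [hAc, hBc] at e₁ e₂
  rw [← e₂, ← e₁] at e₃
  rw [sum_comm, hT, sum_comm, hF] at e₃
  simp only [sum_const, card_univ, Fintype.card_fun, Fintype.card_bool, nsmul_eq_mul,
    Nat.cast_pow, Nat.cast_ofNat] at e₃
  have hLL : L' = L + (d - 1).choose (τ - 1) := by
    rw [hL', hL, ← sum_range_succ, Nat.sub_add_cancel h0]
  have hM := sum_choose_range_succ_add h0 hτ h1
  rw [← hL, ← hL', ← hN] at hM
  have hN0 : 0 < N := by positivity
  set M := ∑ k ∈ Ico (d - τ) (τ - 1), ((d - 1).choose k : ℝ)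
  set C : ℝ := ((d - 1).choose (τ - 1) : ℝ)
  have hM' : M = L + L' - N := by linarith
  rw [← hN] at e₃
  rw [hM', hLL]
  rw [hLL] at e₃
  field_simp
  linarith

set_option maxRecDepth 10000 in
theorem choose_threshold_small : ∀ d ∈ range 144, ∀ τ ∈ range (d + 1),
    2 ≤ d ∧ d < 2 * τ ∧ d ≤ (2 * τ - d) ^ 2 ∧ (2 * τ - d - 2) ^ 2 < d →
      81 * (2 ^ (d - 1)) ^ 4 ≤ 1024 * d *
        ((d - 1).descFactorial (τ - 1) / (τ - 1).factorial *
          ∑ k ∈ Ico (d - τ) (τ - 1), (d - 1).descFactorial k / k.factorial) ^ 2 := by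
  decide +kernel

theorem choose_recurrence {m e l : ℕ} (h : l + 1 ≤ m + e) :
    ((2 * m + e - 1).choose (m + (l + 1)) : ℝ) =
      (2 * m + e - 1).choose (m + l) * ((m + e - l - 1) / (m + l + 1)) := by
  have h₁ := Nat.choose_succ_right_eq (2 * m + e - 1) (m + l)
  have h₂ : 2 * m + e - 1 - (m + l) = m + e - (l + 1) := by omega
  rw [h₂] at h₁
  have h₃ : (((2 * m + e - 1).choose (m + l + 1) * (m + l + 1) : ℕ) : ℝ) =
    ((2 * m + e - 1).choose (m + l) * (m + e - (l + 1)) : ℕ) := by exact_mod_cast h₁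
  push_cast [Nat.cast_sub h] at h₃
  rw [← add_assoc, mul_div_assoc', eq_div_iff (by positivity), h₃]
  ring

theorem sq_centralBinom_div_ge (m : ℕ) :
    2 / (Real.pi * (2 * m + 1)) ≤ (m.centralBinom / 4 ^ m : ℝ) ^ 2 := by
  have h₁ := Real.Wallis.W_le m
  rw [Real.Wallis.W_eq_factorial_ratio] at h₁
  have h₂ : (m.centralBinom : ℝ) * (m.factorial : ℝ) ^ 2 = (2 * m).factorial := by
    have := Nat.choose_mul_factorial_mul_factorial (show m ≤ 2 * m by omega)
    rw [show 2 * m - m = m by omega] at this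
    rw [Nat.centralBinom, ← this]; push_cast; ring
  have h₃ : (0 : ℝ) < m.centralBinom := by exact_mod_cast Nat.centralBinom_pos m
  have h₄ : (0 : ℝ) < m.factorial := by positivity
  have h₅ : (2 : ℝ) ^ (4 * m) = (4 ^ m) ^ 2 := by
    rw [← pow_mul, show (4 : ℝ) = 2 ^ 2 by norm_num, ← pow_mul]; congr 1; ring
  rw [← h₂, h₅, div_le_iff₀ (by positivity)] at h₁
  have h₆ := Real.pi_pos
  rw [div_pow, div_le_div_iff₀ (by positivity) (by positivity)]
  have h₇ : (0 : ℝ) < m.factorial ^ 4 := by positivity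
  refine le_of_mul_le_mul_right ?_ h₇
  nlinarith [h₁]

section Decay
variable {m e : ℝ} {j : ℕ} {a : ℕ → ℝ}

theorem decay_nonneg (hm : 0 < m) (hj : j < m + e) (h0 : 0 ≤ a 0)
    (ha : ∀ l < j, a (l + 1) = a l * ((m + e - l - 1) / (m + l + 1))) :
    ∀ l ≤ j, 0 ≤ a l := by
  intro l
  induction l with
  | zero => intro _; exact h0
  | succ l ih =>
    intro hl
    have : ((l + 1 : ℕ) : ℝ) ≤ j := by exact_mod_cast hl
    push_cast at this
    rw [ha l hl]
    exact mul_nonneg (ih (by omega)) (div_nonneg (by linarith) (by positivity))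

theorem decay_linear_le (he1 : e ≤ 1) (hm : 0 < m) (hj : j < m + e) (h0 : 0 ≤ a 0)
    (ha : ∀ l < j, a (l + 1) = a l * ((m + e - l - 1) / (m + l + 1))) :
    ∀ l ≤ j, a 0 * (1 - (l * (l + 1) - e * l) / (m + 1)) ≤ a l := by
  intro l
  induction l with
  | zero => simp
  | succ l ih =>
    intro hl
    have hlj : ((l + 1 : ℕ) : ℝ) ≤ j := by exact_mod_cast hl
    push_cast at hlj
    have hl0 : (0 : ℝ) ≤ l := by positivity
    have h₁ := ih (by omega)
    set B := (2 * (l + 1) - e) / (m + 1) with hB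
    have hB0 : 0 ≤ B := div_nonneg (by linarith) (by linarith)
    have h₂ : 1 - B ≤ (m + e - l - 1) / (m + l + 1) := by
      have : (m + e - l - 1) / (m + l + 1) = 1 - (2 * (l + 1) - e) / (m + l + 1) := by
        field_simp; ring
      rw [this]
      exact sub_le_sub_left (div_le_div_of_nonneg_left (by linarith) (by linarith) (by linarith)) _
    set A := (l * (l + 1) - e * l) / (m + 1) with hA
    have hA0 : 0 ≤ A := div_nonneg (by nlinarith) (by linarith)
    have h₃ : (((l + 1 : ℕ) : ℝ) * ((l + 1 : ℕ) + 1) - e * (l + 1 : ℕ)) / (m + 1) = A + B := by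
      rw [hA, hB]; push_cast; field_simp; ring
    have hq : 0 ≤ (m + e - l - 1) / (m + l + 1) := div_nonneg (by linarith) (by positivity)
    have hq1 : (m + e - l - 1) / (m + l + 1) ≤ 1 := by
      rw [div_le_one (by positivity)]; linarith
    rw [h₃, ha l hl]
    refine le_trans ?_ (mul_le_mul_of_nonneg_right h₁ hq)
    rw [mul_assoc]
    refine mul_le_mul_of_nonneg_left ?_ h0
    nlinarith

theorem decay_exp_le (he1 : e ≤ 1) (hm : 0 < m) (hj : j < m + e) (h0 : 0 ≤ a 0)
    (ha : ∀ l < j, a (l + 1) = a l * ((m + e - l - 1) / (m + l + 1))) :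
    ∀ l ≤ j, a 0 * Real.exp (-((l * (l + 1) - e * l) / (m + e - j))) ≤ a l := by
  intro l
  induction l with
  | zero => simp
  | succ l ih =>
    intro hl
    have hlj : ((l + 1 : ℕ) : ℝ) ≤ j := by exact_mod_cast hl
    push_cast at hlj
    have hl0 : (0 : ℝ) ≤ l := by positivity
    have hD : 0 < m + e - j := by linarith
    have hD' : 0 < m + e - l - 1 := by linarith
    have h₃ : (((l + 1 : ℕ) : ℝ) * ((l + 1 : ℕ) + 1) - e * (l + 1 : ℕ)) / (m + e - j) =
        (l * (l + 1) - e * l) / (m + e - j) + (2 * (l + 1) - e) / (m + e - j) := by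
      push_cast; field_simp; ring
    rw [h₃, ha l hl, neg_add, Real.exp_add, ← mul_assoc]
    refine mul_le_mul (ih (by omega)) ?_ (Real.exp_pos _).le
      (decay_nonneg hm hj h0 ha l (by omega))
    rw [Real.exp_neg, inv_le_comm₀ (Real.exp_pos _) (by positivity), inv_div]
    have : (m + l + 1) / (m + e - l - 1) = (2 * (l + 1) - e) / (m + e - l - 1) + 1 := by
      field_simp; ring
    rw [this]
    refine le_trans ?_ (Real.add_one_le_exp _)
    gcongr ?_ + 1
    exact div_le_div_of_nonneg_left (by linarith) hD (by linarith)

theorem decay_sum_le (he1 : e ≤ 1) (hm : 0 < m) (hj : j < m + e) (h0 : 0 ≤ a 0)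
    (ha : ∀ l < j, a (l + 1) = a l * ((m + e - l - 1) / (m + l + 1))) :
    ∀ l ≤ j, a 0 * (l - ((l - 1) * l * (l + 1) / 3 - e * (l * (l - 1) / 2)) / (m + 1)) ≤
      ∑ r ∈ range l, a r := by
  intro l
  induction l with
  | zero => simp
  | succ l ih =>
    intro hl
    rw [sum_range_succ]
    refine le_trans (le_of_eq ?_)
      (add_le_add (ih (by omega)) (decay_linear_le he1 hm hj h0 ha l (by omega)))
    push_cast; field_simp; ring

end Decay

theorem sum_Ico_choose_eq {m e : ℕ} (he : e ≤ 1) (hm : 0 < m) {j : ℕ} (hj : j + 1 ≤ m + e) :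
    (∑ k ∈ Ico (m + e - (j + 1)) (m + j), ((2 * m + e - 1).choose k : ℝ)) =
      2 * ∑ l ∈ range j, ((2 * m + e - 1).choose (m + l) : ℝ) +
        (2 * m + e - 1).choose (m + j) - e * (2 * m + e - 1).choose m := by
  have hs : ∀ l, l + 1 ≤ m + e →
      (2 * m + e - 1).choose (m + e - (l + 1)) = (2 * m + e - 1).choose (m + l) := by
    intro l hl
    rw [← Nat.choose_symm (by omega)]
    congr 1
    omega
  induction j with
  | zero =>
    interval_cases e
    · have := hs 0 (by omega)
      obtain ⟨m, rfl⟩ : ∃ k, m = k + 1 := ⟨m - 1, by omega⟩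
      simp at this ⊢
      rw [this]
    · simp
  | succ j ih =>
    rw [show m + (j + 1) = m + j + 1 by ring, sum_Ico_succ_top (by omega),
      sum_eq_sum_Ico_succ_bot (by omega),
      show m + e - (j + 1 + 1) + 1 = m + e - (j + 1) by omega, ih (by omega), hs (j + 1) hj,
      sum_range_succ]
    rw [← add_assoc]; ring

theorem numeric_bound {x y v w : ℝ} (hx : 12 ≤ x) (hy1 : x - 1 ≤ y) (hy2 : y ≤ x + 1)
    (hv : v ≤ y ^ 2 / (2 * x ^ 2 - 2 * y + 2)) (hw : w ≤ (y ^ 2 + 2) / (6 * (x ^ 2 + 1))) :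
    9 / 32 / x ≤ 2 / (Real.pi * (x ^ 2 + 1)) * Real.exp (-v) * (y * (1 - w)) := by
  obtain ⟨r, rfl⟩ : ∃ r, y = r * x := ⟨y / x, by field_simp⟩
  have hx0 : 0 < x := by linarith
  have hr1 : 11 / 12 ≤ r := by
    by_contra! h
    nlinarith
  have hr2 : r ≤ 13 / 12 := by
    by_contra! h
    nlinarith
  have hv' : v ≤ 6 / 11 * r ^ 2 := by
    refine hv.trans ?_
    rw [div_le_iff₀ (by nlinarith)]
    have : 11 / 6 * x ^ 2 ≤ 2 * x ^ 2 - 2 * (r * x) + 2 := by nlinarith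
    nlinarith [mul_le_mul_of_nonneg_left this (sq_nonneg r)]
  have hw' : w ≤ r ^ 2 / 6 + 1 / 432 := by
    refine hw.trans ?_
    rw [div_le_iff₀ (by positivity)]
    nlinarith [sq_nonneg r]
  have hexp : 0.606 * (3 / 2 - 6 / 11 * r ^ 2) ≤ Real.exp (-v) := by
    have h₁ : (0.606 : ℝ) ≤ Real.exp (-(1 / 2)) := by
      have h₂ : Real.exp (-(1 / 2)) ^ 2 * Real.exp 1 = 1 := by
        rw [← Real.exp_nat_mul, ← Real.exp_add]; norm_num
      by_contra! h
      have h₃ := Real.exp_one_lt_d9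
      have h₄ : Real.exp (-(1 / 2)) ^ 2 ≤ 0.606 ^ 2 := by
        gcongr
      nlinarith [Real.exp_pos 1, sq_nonneg (Real.exp (-(1 / 2)))]
    have h₂ : 3 / 2 - 6 / 11 * r ^ 2 ≤ Real.exp (1 / 2 - v) := by
      linarith [Real.add_one_le_exp (1 / 2 - v)]
    have h₃ : Real.exp (-v) = Real.exp (-(1 / 2)) * Real.exp (1 / 2 - v) := by
      rw [← Real.exp_add]; congr 1; ring
    rw [h₃]
    refine mul_le_mul h₁ h₂ ?_ (Real.exp_pos _).le
    nlinarith
  have hpi := Real.pi_lt_d4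
  have hpi0 := Real.pi_pos
  have h₁ : 9 / 32 * (3.1416 * 145 / 144) ≤
      2 * (0.606 * (3 / 2 - 6 / 11 * r ^ 2)) * (r * (1 - (r ^ 2 / 6 + 1 / 432))) := by
    obtain ⟨z, rfl⟩ : ∃ z, r = 13 / 12 - z := ⟨13 / 12 - r, by ring⟩
    have hz0 : 0 ≤ z := by linarith
    have hz1 : z ≤ 1 / 6 := by linarith
    nlinarith [mul_nonneg hz0 (sub_nonneg.2 hz1), mul_nonneg (mul_nonneg hz0 hz0) (sub_nonneg.2 hz1), pow_nonneg hz0 3, pow_nonneg hz0 4,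
      mul_nonneg (pow_nonneg hz0 3) (sub_nonneg.2 hz1), mul_nonneg (pow_nonneg hz0 4) (sub_nonneg.2 hz1)]
  have h₂ : 2 * (0.606 * (3 / 2 - 6 / 11 * r ^ 2)) * (r * (1 - (r ^ 2 / 6 + 1 / 432))) ≤
      2 * Real.exp (-v) * (r * (1 - w)) := by
    have : (0 : ℝ) ≤ 1 - (r ^ 2 / 6 + 1 / 432) := by nlinarith
    gcongr
  have h₃ : Real.pi * (x ^ 2 + 1) ≤ 3.1416 * 145 / 144 * x ^ 2 := by nlinarith
  rw [div_mul_eq_mul_div, div_mul_eq_mul_div, div_le_div_iff₀ hx0 (by positivity)]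
  calc 9 / 32 * (Real.pi * (x ^ 2 + 1)) ≤ 9 / 32 * (3.1416 * 145 / 144 * x ^ 2) := by gcongr
    _ = 9 / 32 * (3.1416 * 145 / 144) * x ^ 2 := by ring
    _ ≤ 2 * Real.exp (-v) * (r * (1 - w)) * x ^ 2 := by exact mul_le_mul_of_nonneg_right (h₁.trans h₂) (sq_nonneg x)
    _ = _ := by ring

theorem choose_threshold_large {d τ : ℕ} (hd : 144 ≤ d) (hτ : τ ≤ d) (h1 : d < 2 * τ)
    (h2 : √d ≤ 2 * τ - d) (h3 : 2 * (τ : ℝ) - d < √d + 2) :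
    9 / 32 / √d ≤ (d - 1).choose (τ - 1) *
      (∑ k ∈ Ico (d - τ) (τ - 1), ((d - 1).choose k : ℝ)) / (2 ^ (d - 1)) ^ 2 := by
  obtain ⟨m, e, he, rfl⟩ : ∃ m e, e ≤ 1 ∧ d = 2 * m + e :=
    ⟨d / 2, d % 2, by omega, by omega⟩
  obtain ⟨j, rfl⟩ : ∃ j, τ = m + j + 1 := ⟨τ - m - 1, by omega⟩
  set x := √((2 * m + e : ℕ) : ℝ) with hx
  have hxsq : x ^ 2 = 2 * m + e := by
    rw [hx, Real.sq_sqrt (by positivity)]; push_cast; rfl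
  have hx12 : 12 ≤ x := Real.le_sqrt_of_sq_le (by exact_mod_cast hd)
  have hm : 0 < m := by omega
  have hmR : (0 : ℝ) < m := by exact_mod_cast hm
  have heR : (e : ℝ) ≤ 1 := by exact_mod_cast he
  have hjR : (j : ℝ) < m + e := by exact_mod_cast (by omega : j < m + e)
  push_cast at h2 h3
  have hy1 : x - 1 ≤ 2 * j + 1 - e := by linarith
  have hy2 : 2 * j + 1 - e ≤ x + 1 := by linarith
  set a : ℕ → ℝ := fun l => ((2 * m + e - 1).choose (m + l) : ℝ) with ha
  have hrec : ∀ l < j, a (l + 1) = a l * ((m + e - l - 1) / (m + l + 1)) :=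
    fun l hl => choose_recurrence (by omega)
  have h0 : 0 ≤ a 0 := by positivity
  have hlin := decay_linear_le heR hmR hjR h0 hrec j le_rfl
  have hexp := decay_exp_le heR hmR hjR h0 hrec j le_rfl
  have hsum := decay_sum_le heR hmR hjR h0 hrec j le_rfl
  have hM : a 0 * ((2 * j + 1 - e) * (1 - (j * (j + 1) - e * j + e / 2) / (3 * (m + 1)))) ≤
      ∑ k ∈ Ico (2 * m + e - (m + j + 1)) (m + j + 1 - 1), ((2 * m + e - 1).choose k : ℝ) := by
    rw [show 2 * m + e - (m + j + 1) = m + e - (j + 1) by omega, Nat.add_sub_cancel,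
      sum_Ico_choose_eq he hm (by omega)]
    change _ ≤ 2 * ∑ l ∈ range j, a l + a j - e * a 0
    refine le_trans (le_of_eq ?_) (sub_le_sub_right (add_le_add
      (mul_le_mul_of_nonneg_left hsum zero_le_two) hlin) _)
    interval_cases e
    · push_cast; field_simp; ring
    · push_cast; field_simp; ring
  have hcentral : a 0 / 2 ^ (2 * m + e - 1) = m.centralBinom / 4 ^ m := by
    simp only [ha, add_zero]
    interval_cases e
    · obtain ⟨k, rfl⟩ : ∃ k, m = k + 1 := ⟨m - 1, by omega⟩
      rw [Nat.centralBinom_eq_two_mul_choose,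
        show 2 * (k + 1) = 2 * k + 1 + 1 by ring, Nat.choose_succ_succ, show (4 : ℝ) ^ (k + 1) = 2 ^ (2 * k + 1) * 2 by
          rw [show (4 : ℝ) = 2 ^ 2 by norm_num, ← pow_mul, ← pow_succ]; congr 1]
      have : (2 * k + 1).choose (k + 1) = (2 * k + 1).choose k := Nat.choose_symm_half k
      simp [this]
      field_simp; ring
    · rw [Nat.add_sub_cancel, pow_mul, Nat.centralBinom_eq_two_mul_choose]; norm_num
  have hcent := sq_centralBinom_div_ge m
  rw [← hcentral] at hcent
  have hnum := numeric_bound (v := (j * (j + 1) - e * j) / (m + e - j))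
    (w := (j * (j + 1) - e * j + e / 2) / (3 * (m + 1))) hx12 hy1 hy2
    (by
      have h₁ : 4 * (j * (j + 1) - e * j) ≤ (2 * j + 1 - e : ℝ) ^ 2 := by
        nlinarith only [sq_nonneg (1 - e : ℝ)]
      rw [hxsq, show 2 * (2 * m + e) - 2 * (2 * j + 1 - e) + 2 = 4 * (m + e - j : ℝ) by ring,
        ← mul_div_mul_left _ _ (four_ne_zero' ℝ)]
      exact div_le_div_of_nonneg_right h₁ (by linarith))
    (by
      have h₁ : 4 * (j * (j + 1) - e * j + e / 2) ≤ (2 * j + 1 - e : ℝ) ^ 2 + 2 := by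
        nlinarith only [sq_nonneg (1 - e : ℝ), heR]
      rw [hxsq, ← mul_div_mul_left _ _ (four_ne_zero' ℝ)]
      exact div_le_div₀ (by positivity) h₁ (by positivity) (by linarith))
  have hC : 2 / (Real.pi * (x ^ 2 + 1)) ≤ (a 0 / 2 ^ (2 * m + e - 1)) ^ 2 := by
    refine le_trans ?_ hcent
    rw [hxsq]
    have := Real.pi_pos
    gcongr
    linarith
  set w : ℝ := (j * (j + 1) - e * j + e / 2) / (3 * (m + 1))
  set v : ℝ := (j * (j + 1) - e * j) / (m + e - j)
  have hS : 0 ≤ (2 * j + 1 - e) * (1 - w) := by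
    by_contra! h
    have h₁ : 0 < 9 / 32 / x := by positivity
    have h₂ : 0 ≤ 2 / (Real.pi * (x ^ 2 + 1)) * Real.exp (-v) := by
      have := Real.pi_pos
      positivity
    nlinarith
  calc 9 / 32 / x ≤ _ := hnum
    _ ≤ (a 0 / 2 ^ (2 * m + e - 1)) ^ 2 * Real.exp (-v) * ((2 * j + 1 - e) * (1 - w)) := by
      gcongr
    _ = (a 0 * Real.exp (-v)) * (a 0 * ((2 * j + 1 - e) * (1 - w))) /
        (2 ^ (2 * m + e - 1)) ^ 2 := by ring
    _ ≤ _ := by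
      gcongr
      rw [Nat.add_sub_cancel]
      exact hexp

theorem choose_threshold {d τ : ℕ} (hd : 2 ≤ d) (hτ : τ ≤ d) (h1 : d < 2 * τ)
    (h2 : √d ≤ 2 * τ - d) (h3 : 2 * (τ : ℝ) - d < √d + 2) :
    9 / 32 / √d ≤ (d - 1).choose (τ - 1) *
      (∑ k ∈ Ico (d - τ) (τ - 1), ((d - 1).choose k : ℝ)) / (2 ^ (d - 1)) ^ 2 := by
  rcases le_or_gt 144 d with h | h
  · exact choose_threshold_large h hτ h1 h2 h3
  have hdR : (0 : ℝ) < d := by exact_mod_cast (by omega : 0 < d)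
  have h2' : d ≤ (2 * τ - d) ^ 2 := by
    have : (d : ℝ) ≤ (2 * τ - d) ^ 2 := (Real.sqrt_le_left (by
      have := Real.sqrt_nonneg d; linarith)).1 (by exact h2)
    have h4 : ((2 * τ - d : ℕ) : ℝ) = 2 * τ - d := by
      rw [Nat.cast_sub h1.le]; push_cast; ring
    rw [← h4] at this
    exact_mod_cast this
  have h3' : (2 * τ - d - 2) ^ 2 < d := by
    rcases le_or_gt (2 * τ - d) 2 with h5 | h5
    · rw [Nat.sub_eq_zero_of_le h5]; omega
    · have h4 : ((2 * τ - d - 2 : ℕ) : ℝ) = 2 * τ - d - 2 := by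
        rw [Nat.cast_sub h5.le, Nat.cast_sub h1.le]; push_cast; ring
      have : ((2 * τ - d - 2 : ℕ) : ℝ) < √d := by rw [h4]; linarith
      rw [Real.lt_sqrt (by positivity)] at this
      exact_mod_cast this
  have key := choose_threshold_small d (mem_range.2 h) τ (mem_range.2 (by omega))
    ⟨hd, h1, h2', h3'⟩
  simp only [← Nat.choose_eq_descFactorial_div_factorial] at key
  have key' : (81 : ℝ) * (2 ^ (d - 1)) ^ 4 ≤ 1024 * d * ((d - 1).choose (τ - 1) *
      (∑ k ∈ Ico (d - τ) (τ - 1), ((d - 1).choose k : ℝ))) ^ 2 := by exact_mod_cast key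
  set X := ((d - 1).choose (τ - 1) : ℝ) * (∑ k ∈ Ico (d - τ) (τ - 1), ((d - 1).choose k : ℝ))
  have hX : 0 ≤ X := by positivity
  have hs := Real.sq_sqrt hdR.le
  rw [div_div, div_le_div_iff₀ (by positivity) (by positivity)]
  refine (sq_le_sq₀ (by positivity) (by positivity)).1 ?_
  nlinarith


theorem stmt17 {V : Type*} [Fintype V] [DecidableEq V]
    (d : ℕ) (hd : 2 ≤ d) (τ : ℕ) (hτ : τ = ⌈((d : ℝ) + Real.sqrt d) / 2⌉₊)
    (ε : ℝ) (hε0 : 0 ≤ ε) (hε1 : ε ≤ 1)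
    (G : SimpleGraph V) [DecidableRel G.Adj]
    (hreg : G.IsRegularOfDegree d)
    (htri : ((G.edgeFinset.filter
        (fun e => ∃ w : V, ∀ x ∈ e, G.Adj x w)).card : ℝ) ≤ ε * G.edgeFinset.card) :
    (∑ c : V → Bool,
      ((G.edgeFinset.filter (fun e =>
        ¬ (e.map (fun x =>
          if ((G.neighborFinset x).filter (fun y => c y = c x)).card < τ
          then c x else !(c x))).IsDiag)).card : ℝ))
      / 2 ^ (Fintype.card V)
    ≥ (1 - ε) * (1/2 + 9 / (32 * Real.sqrt d)) * G.edgeFinset.card := by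
  classical
  have hdR : (2 : ℝ) ≤ d := by exact_mod_cast hd
  have hs0 : 0 < √(d : ℝ) := Real.sqrt_pos.2 (by linarith)
  have hsd : √(d : ℝ) ≤ d := Real.sqrt_le_left (by linarith) |>.2 (by nlinarith)
  have hle : ((d : ℝ) + √d) / 2 ≤ τ := hτ ▸ Nat.le_ceil _
  have hlt : (τ : ℝ) < (d + √d) / 2 + 1 := hτ ▸ Nat.ceil_lt_add_one (by positivity)
  have hτd : τ ≤ d := hτ ▸ Nat.ceil_le.2 (by linarith)
  have hdτ : d < 2 * τ := by
    have : (d : ℝ) < 2 * τ := by linarith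
    exact_mod_cast this
  have hbin := choose_threshold hd hτd hdτ (by linarith) (by linarith)
  set f : (V → Bool) → V → Bool := fun c x =>
    if ((G.neighborFinset x).filter (fun y => c y = c x)).card < τ then c x else !(c x)
  set T := {e ∈ G.edgeFinset | ∃ w : V, ∀ x ∈ e, G.Adj x w}
  set U := {e ∈ G.edgeFinset | ¬ ∃ w : V, ∀ x ∈ e, G.Adj x w}
  have hTU : (#T : ℝ) + #U = #G.edgeFinset := by
    exact_mod_cast card_filter_add_card_filter_not (s := G.edgeFinset) _
  have hedge : ∀ e ∈ U, 2 ^ Fintype.card V * (1 / 2 + 9 / (32 * √d)) ≤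
      ∑ c : V → Bool, if ¬ (e.map (f c)).IsDiag then (1 : ℝ) else 0 := by
    intro e he
    induction e with | _ u v
    simp only [U, mem_filter, SimpleGraph.mem_edgeFinset, SimpleGraph.mem_edgeSet,
      Sym2.mem_iff, forall_eq_or_imp, forall_eq] at he
    simp only [Sym2.map_mk, Sym2.mk_isDiag_iff]
    have := card_separated_eq (f := f) (by omega) (by omega) hτd hdτ hreg he.1 he.2
      (fun _ _ => rfl)
    simp only [ne_eq] at this
    rw [this, ← div_div]
    gcongr
  have hsum : (∑ c : V → Bool, (#{e ∈ G.edgeFinset | ¬ (e.map (f c)).IsDiag} : ℝ)) =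
      ∑ e ∈ G.edgeFinset, ∑ c : V → Bool, if ¬ (e.map (f c)).IsDiag then (1 : ℝ) else 0 := by
    rw [sum_comm]
    simp only [sum_boole]
  have hge : #U * (2 ^ Fintype.card V * (1 / 2 + 9 / (32 * √d))) ≤
      ∑ c : V → Bool, (#{e ∈ G.edgeFinset | ¬ (e.map (f c)).IsDiag} : ℝ) := by
    rw [hsum, ← nsmul_eq_mul]
    refine (card_nsmul_le_sum U _ _ hedge).trans
      (sum_le_sum_of_subset_of_nonneg (filter_subset _ _) fun e _ _ =>
        sum_nonneg fun c _ => by split_ifs <;> norm_num)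
  rw [ge_iff_le, le_div_iff₀ (by positivity)]
  refine le_trans ?_ hge
  have hU : (1 - ε) * #G.edgeFinset ≤ #U := by linarith
  calc _ = ((1 - ε) * #G.edgeFinset) *
        (2 ^ Fintype.card V * (1 / 2 + 9 / (32 * √(d : ℝ)))) := by ring
    _ ≤ _ := by gcongr
end
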